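/- arXiv:2503.00921 — 5 statements merged into one kernel-verified Lean document; each statement's English description precedes it below -/
import Mathlib

section
/- Let X be a topological space equipped with a jointly Baire measurable scaling T (the map (x,t) ↦ T_t x is measurable for the product of the Baire σ-algebra on X and the Borel σ-algebra on (0,∞)) acting freely on X (if T_t x = x for some x ∈ X then t = 1). Let S be an ideal on X whose union set is all of X and which admits a countable base (D_n)_{n∈ℕ} such that each D_n is a Baire measurable semicone (T_t D_n ⊆ D_n for all t ≥ 1). Let α > 0 and let μ ∈ M(S) be α-homogeneous. Then there exists a finite Baire measure σ on X such that ∫₀^∞ σ(T_t D_n) t^{α−1} dt < ∞ for every n, and μ(B) = α ∫₀^∞ σ(T_t B) t^{α−1} dt for every Baire set B belonging to S. -/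
open MeasureTheory Filter Topology Set
open scoped ENNReal NNReal

noncomputable section

/-- The Baire σ-algebra on a topological space: the smallest σ-algebra making all
continuous real-valued functions measurable. -/
def baire (X : Type*) [TopologicalSpace X] : MeasurableSpace X :=
  ⨆ f : { g : X → ℝ // Continuous g }, MeasurableSpace.comap f.1 (borel ℝ)

/-- An ideal of subsets: closed under finite unions and under taking subsets. -/
def IsSetIdeal {X : Type*} (S : Set (Set X)) : Prop :=
  (∀ A ∈ S, ∀ B ∈ S, A ∪ B ∈ S) ∧ ∀ A B : Set X, B ∈ S → A ⊆ B → A ∈ S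

/-- A scaling: an action of the multiplicative group `(0, ∞)`. -/
def IsScaling {X : Type*} (T : ℝ → X → X) : Prop :=
  (∀ x, T 1 x = x) ∧ ∀ t s : ℝ, 0 < t → 0 < s → ∀ x, T t (T s x) = T (t * s) x

/-- Joint continuity of the scaling on `(0,∞) × X`. -/
def ContinuousScaling {X : Type*} [TopologicalSpace X] (T : ℝ → X → X) : Prop :=
  ContinuousOn (fun p : ℝ × X => T p.1 p.2) (Set.Ioi (0:ℝ) ×ˢ (Set.univ : Set X))

/-- A functionally open set: `{x | 0 < f x}` for a continuous nonnegative `f`. -/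
def FunctionallyOpen {X : Type*} [TopologicalSpace X] (G : Set X) : Prop :=
  ∃ f : X → ℝ, Continuous f ∧ (∀ x, 0 ≤ f x) ∧ G = {x | 0 < f x}

def FunctionallyClosed {X : Type*} [TopologicalSpace X] (F : Set X) : Prop :=
  FunctionallyOpen Fᶜ

/-- Topological consistency of an ideal. -/
def TopConsistent {X : Type*} [TopologicalSpace X] (S : Set (Set X)) : Prop :=
  (∀ B ∈ S, ∃ F ∈ S, FunctionallyClosed F ∧ B ⊆ F) ∧
    ∀ x ∈ ⋃₀ S, ∃ G ∈ S, FunctionallyOpen G ∧ x ∈ G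

/-- Scaling consistency of an ideal. -/
def ScalConsistent {X : Type*} (T : ℝ → X → X) (S : Set (Set X)) : Prop :=
  ∀ B ∈ S, ∀ t : ℝ, 0 < t → T t '' B ∈ S

/-- Membership in `M(S)`: finite on the measurable members of `S` and vanishing
outside the union set of `S`. -/
def MemM {X : Type*} [MeasurableSpace X] (S : Set (Set X)) (μ : Measure X) : Prop :=
  (∀ B ∈ S, MeasurableSet B → μ B < ⊤) ∧ μ (⋃₀ S)ᶜ = 0

/-- Nontriviality of a measure on an ideal. -/
def NontrivialOn {X : Type*} [MeasurableSpace X] (S : Set (Set X)) (μ : Measure X) : Prop :=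
  ∃ B ∈ S, 0 < μ B

/-- A bounded continuous function whose support belongs to the ideal `S`. -/
def TestFun {X : Type*} [TopologicalSpace X] (S : Set (Set X)) (f : X → ℝ) : Prop :=
  Continuous f ∧ (∃ C : ℝ, ∀ x, |f x| ≤ C) ∧ Function.support f ∈ S

/-- Vague convergence on the ideal `S` of a net of measures along the filter `l`. -/
def VagueTendsto {X : Type*} {ι : Type*} [TopologicalSpace X] [MeasurableSpace X]
    (S : Set (Set X)) (μs : ι → Measure X) (l : Filter ι) (μ : Measure X) : Prop :=
  ∀ f : X → ℝ, TestFun S f →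
    Tendsto (fun i => ∫ x, f x ∂(μs i)) l (𝓝 (∫ x, f x ∂μ))

/-- `ν ∈ RV(X, T, S, g, μ)`: the measure `ν` is regularly varying on the ideal `S`
with normalising function `g` and (nontrivial) tail measure `μ`. -/
def MeasureRV {X : Type*} [TopologicalSpace X] [MeasurableSpace X]
    (T : ℝ → X → X) (S : Set (Set X)) (g : ℝ → ℝ) (ν μ : Measure X) : Prop :=
  Measurable g ∧ (∀ t : ℝ, 0 < t → 0 < g t) ∧ Tendsto g atTop atTop ∧
    MemM S μ ∧ NontrivialOn S μ ∧
    ∀ f : X → ℝ, TestFun S f →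
      Tendsto (fun t : ℝ => g t * ∫ x, f (T t⁻¹ x) ∂ν) atTop (𝓝 (∫ x, f x ∂μ))

/-- A finite (real-valued) modulus: a nonnegative homogeneous function. -/
def IsModulus {X : Type*} (T : ℝ → X → X) (τ : X → ℝ) : Prop :=
  (∀ x, 0 ≤ τ x) ∧ ∀ t : ℝ, 0 < t → ∀ x, τ (T t x) = t * τ x

/-- A `[0,∞]`-valued modulus: a homogeneous function. -/
def IsModulusE {X : Type*} (T : ℝ → X → X) (τ : X → ℝ≥0∞) : Prop :=
  ∀ t : ℝ, 0 < t → ∀ x, τ (T t x) = ENNReal.ofReal t * τ x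

/-- The ideal generated by a real-valued modulus. -/
def SIdeal {X : Type*} (τ : X → ℝ) : Set (Set X) :=
  {A | ∃ ε : ℝ, 0 < ε ∧ ∀ x ∈ A, ε ≤ τ x}

/-- The ideal generated by a `[0,∞]`-valued modulus. -/
def SIdealE {X : Type*} (τ : X → ℝ≥0∞) : Set (Set X) :=
  {A | ∃ ε : ℝ≥0∞, 0 < ε ∧ ∀ x ∈ A, ε ≤ τ x}

/-- Condition (B). -/
def CondB {X : Type*} [TopologicalSpace X] (T : ℝ → X → X) (S : Set (Set X)) : Prop :=
  ∃ V : Set X, FunctionallyOpen V ∧ (∀ t : ℝ, 1 ≤ t → T t '' V ⊆ V) ∧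
    (⋂ t ∈ Set.Ioi (1:ℝ), T t '' V) = ∅ ∧
    (∀ n : ℕ, T ((n : ℝ) + 1)⁻¹ '' V ∈ S) ∧
    (∀ A ∈ S, ∃ n : ℕ, A ⊆ T ((n : ℝ) + 1)⁻¹ '' V) ∧
    ∃ F : Set X, FunctionallyClosed F ∧ V ⊆ F ∧
      ∀ s : ℝ, 0 < s → s < 1 → F ⊆ T s '' V

/-- Condition (B₀): the ideal is generated by a family of finite continuous moduli. -/
def CondB0 {X : Type*} [TopologicalSpace X] (T : ℝ → X → X) (S : Set (Set X)) : Prop :=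
  ∃ Tf : Set (X → ℝ), (∀ τ ∈ Tf, Continuous τ ∧ IsModulus T τ) ∧
    ∀ A : Set X, A ∈ S ↔
      ∃ I : Finset (X → ℝ), ↑I ⊆ Tf ∧ ∃ ε : ℝ, 0 < ε ∧ ∀ x ∈ A, ∃ τ' ∈ I, ε ≤ τ' x

/-- `g ∈ RV_α`: regular variation of index `α` at infinity. -/
def RegVary (g : ℝ → ℝ) (α : ℝ) : Prop :=
  ∀ x : ℝ, 0 < x → Tendsto (fun t => g (x * t) / g t) atTop (𝓝 (x ^ α))

/-- τ-additivity of a (Baire) measure. -/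
def TauAdditive {X : Type*} [TopologicalSpace X] [MeasurableSpace X] (μ : Measure X) : Prop :=
  ∀ 𝒢 : Set (Set X), 𝒢.Nonempty → (∀ G ∈ 𝒢, FunctionallyOpen G) →
    DirectedOn (· ⊆ ·) 𝒢 → FunctionallyOpen (⋃₀ 𝒢) →
    μ (⋃₀ 𝒢) = ⨆ G ∈ 𝒢, μ G

/-- α-homogeneity of a measure: `μ(T_t B) = t^{-α} μ(B)`. -/
def HomogeneousMeasure {X : Type*} [MeasurableSpace X] (T : ℝ → X → X) (α : ℝ)
    (μ : Measure X) : Prop :=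
  ∀ t : ℝ, 0 < t → ∀ B : Set X, MeasurableSet B →
    μ (T t '' B) = ENNReal.ofReal (t ^ (-α)) * μ B

/-- Perfect normality: disjoint closed sets are precisely separated. -/
def PerfectlyNormal (X : Type*) [TopologicalSpace X] : Prop :=
  ∀ F₁ F₂ : Set X, IsClosed F₁ → IsClosed F₂ → Disjoint F₁ F₂ →
    ∃ f : X → ℝ, Continuous f ∧ (∀ x, f x ∈ Set.Icc (0:ℝ) 1) ∧
      F₁ = f ⁻¹' {0} ∧ F₂ = f ⁻¹' {1}

lemma indicator_congr_of_mem_iff {α β M : Type*} [Zero M] {s : Set α} {t : Set β} {f : α → M}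
    {g : β → M} {a : α} {b : β} (h : a ∈ s ↔ b ∈ t) (hfg : f a = g b) :
    s.indicator f a = t.indicator g b := by
  by_cases hb : b ∈ t
  · rw [indicator_of_mem hb, indicator_of_mem (h.2 hb), hfg]
  · rw [indicator_of_notMem hb, indicator_of_notMem (mt h.1 hb)]

/-- The image of a set under one map of a scaling is the preimage under the inverse map. -/
lemma IsScaling.image_eq_preimage {X : Type*} {T : ℝ → X → X} (hT : IsScaling T) {t : ℝ}
    (ht : 0 < t) (B : Set X) : T t '' B = T t⁻¹ ⁻¹' B := by
  ext x
  constructor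
  · rintro ⟨y, hy, rfl⟩
    rwa [mem_preimage, hT.2 _ _ (inv_pos.2 ht) ht, inv_mul_cancel₀ ht.ne', hT.1]
  · intro hx
    exact ⟨_, hx, by rw [hT.2 _ _ ht (inv_pos.2 ht), mul_inv_cancel₀ ht.ne', hT.1]⟩

lemma tendsto_ofReal_rpow_neg_mul {α : ℝ} (hα : 0 < α) {M : ℝ≥0∞} (hM : M ≠ ⊤) :
    Tendsto (fun t : ℝ => ENNReal.ofReal (t ^ (-α)) * M) atTop (𝓝 0) := by
  have h := ENNReal.tendsto_ofReal (tendsto_rpow_neg_atTop hα)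
  simpa using ENNReal.Tendsto.mul_const h (Or.inr hM)

lemma measurable_scaling {X : Type*} [MeasurableSpace X] {T : ℝ → X → X}
    (hTmeas : Measurable fun p : X × Set.Ioi (0:ℝ) => T (p.2 : ℝ) p.1) {t : ℝ} (ht : 0 < t) :
    Measurable (T t) :=
  hTmeas.comp (measurable_id.prodMk (measurable_const (a := (⟨t, ht⟩ : Set.Ioi (0:ℝ)))))

/-- The unit shell `[r, re)` of a half-line with infimum `r > 0` has mass `1` for `dt/t`. -/
lemma lintegral_inv_shell {P : ℝ → Prop} (hP : ∀ s t, 0 < s → s ≤ t → P s → P t)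
    {u v : ℝ} (hu : 0 < u) (hPu : ¬ P u) (hv : 0 < v) (hPv : P v) :
    ∫⁻ t in Set.Ioi (0:ℝ), {t | P t ∧ ¬ P (t * (Real.exp 1)⁻¹)}.indicator
      (fun t => ENNReal.ofReal t⁻¹) t = 1 := by
  have he := Real.exp_pos 1
  set J : Set ℝ := {t | 0 < t ∧ P t}
  set r := sInf J
  have hlow : ∀ t ∈ J, u ≤ t := fun t ht => by
    by_contra! h
    exact hPu (hP t u ht.1 h.le ht.2)
  have hne : J.Nonempty := ⟨v, hv, hPv⟩
  have hr0 : 0 < r := hu.trans_le (le_csInf hne hlow)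
  have hbelow : ∀ t, 0 < t → t < r → ¬ P t := fun t ht htr h =>
    notMem_of_lt_csInf htr ⟨u, hlow⟩ ⟨ht, h⟩
  have habove : ∀ t, r < t → P t := fun t htr => by
    obtain ⟨s, hs, hst⟩ := exists_lt_of_csInf_lt hne htr
    exact hP s t hs.1 hst.le hs.2
  have hae : ∀ᵐ t ∂(volume.restrict (Set.Ioi (0:ℝ))),
      {t | P t ∧ ¬ P (t * (Real.exp 1)⁻¹)}.indicator (fun t => ENNReal.ofReal t⁻¹) t =
        (Set.Ioc r (r * Real.exp 1)).indicator (fun t => ENNReal.ofReal t⁻¹) t := by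
    have h1 : ∀ᵐ t ∂(volume.restrict (Set.Ioi (0:ℝ))), t ≠ r :=
      ae_restrict_of_ae (Measure.ae_ne volume r)
    have h2 : ∀ᵐ t ∂(volume.restrict (Set.Ioi (0:ℝ))), t ≠ r * Real.exp 1 :=
      ae_restrict_of_ae (Measure.ae_ne volume _)
    filter_upwards [h1, h2, ae_restrict_mem measurableSet_Ioi] with t h1 h2 (ht : 0 < t)
    refine indicator_congr_of_mem_iff ?_ rfl
    change (P t ∧ ¬ P (t * (Real.exp 1)⁻¹)) ↔ t ∈ Set.Ioc r (r * Real.exp 1)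
    constructor
    · rintro ⟨ha, hb⟩
      refine ⟨lt_of_le_of_ne (not_lt.1 fun h => hbelow t ht h ha) h1.symm, ?_⟩
      by_contra! h
      exact hb (habove _ (by rwa [← div_eq_mul_inv, lt_div_iff₀ he]))
    · rintro ⟨ha, hb⟩
      refine ⟨habove t ha, hbelow _ (by positivity) ?_⟩
      rw [← div_eq_mul_inv, div_lt_iff₀ he]
      exact lt_of_le_of_ne hb h2
  have hrle : r ≤ r * Real.exp 1 := le_mul_of_one_le_right hr0.le (Real.one_le_exp zero_le_one)
  rw [lintegral_congr_ae hae, lintegral_indicator measurableSet_Ioc,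
    Measure.restrict_restrict measurableSet_Ioc,
    inter_eq_left.2 (Ioc_subset_Ioi_self.trans (Ioi_subset_Ioi hr0.le)), ← ofReal_integral_eq_lintegral_ofReal,
    ← intervalIntegral.integral_of_le hrle, integral_inv_of_pos hr0 (by positivity),
    mul_div_cancel_left₀ _ hr0.ne', Real.log_exp, ENNReal.ofReal_one]
  · change IntegrableOn _ _ _
    rw [← intervalIntegrable_iff_integrableOn_Ioc_of_le hrle]
    refine intervalIntegrable_inv_iff.2 (Or.inr fun h => ?_)
    rw [uIcc_of_le hrle] at h
    exact hr0.not_ge h.1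
  · filter_upwards [ae_restrict_mem measurableSet_Ioc] with t ht
    exact (inv_pos.2 (hr0.trans ht.1)).le

/-- Given a countable cover by semicones of finite measure, there is one semicone of finite
measure which meets every orbit. -/
lemma exists_absorbing_semicone {X : Type*} [MeasurableSpace X] {T : ℝ → X → X}
    (hT : IsScaling T) (hTmeas : Measurable fun p : X × Set.Ioi (0:ℝ) => T (p.2 : ℝ) p.1)
    {α : ℝ} (hα : 0 < α) {μ : Measure X} (hhom : HomogeneousMeasure T α μ)
    {D : ℕ → Set X} (hDmeas : ∀ n, MeasurableSet (D n))
    (hDsemi : ∀ n, ∀ t : ℝ, 1 ≤ t → T t '' D n ⊆ D n) (hDfin : ∀ n, μ (D n) ≠ ⊤)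
    (hDcover : ∀ x, ∃ n, x ∈ D n) :
    ∃ V : Set X, MeasurableSet V ∧ μ V ≠ ⊤ ∧ (∀ t : ℝ, 1 ≤ t → ∀ x ∈ V, T t x ∈ V) ∧
      ∀ x, ∃ t : ℝ, 0 < t ∧ T t x ∈ V := by
  obtain ⟨ε, hε, hεsum⟩ := ENNReal.exists_pos_sum_of_countable' one_ne_zero ℕ
  have ha : ∀ n, ∃ a : ℝ, 0 < a ∧ ENNReal.ofReal (a ^ (-α)) * μ (D n) < ε n := fun n =>
    ((eventually_gt_atTop 0).and
      ((tendsto_ofReal_rpow_neg_mul hα (hDfin n)).eventually_lt_const (hε n))).exists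
  choose a ha0 ha using ha
  refine ⟨⋃ n, T (a n) '' D n, .iUnion fun n => ?_, ?_, ?_, fun x => ?_⟩
  · rw [hT.image_eq_preimage (ha0 n)]
    exact measurable_scaling hTmeas (inv_pos.2 (ha0 n)) (hDmeas n)
  · refine ne_top_of_le_ne_top (hεsum.trans ENNReal.one_lt_top).ne
      ((measure_iUnion_le _).trans (ENNReal.tsum_le_tsum fun n => ?_))
    rw [hhom _ (ha0 n) _ (hDmeas n)]
    exact (ha n).le
  · intro t ht x hx
    obtain ⟨n, y, hy, rfl⟩ := mem_iUnion.1 hx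
    have ht0 : 0 < t := zero_lt_one.trans_le ht
    refine mem_iUnion.2 ⟨n, T t y, hDsemi n t ht ⟨y, hy, rfl⟩, ?_⟩
    rw [hT.2 _ _ (ha0 n) ht0, hT.2 _ _ ht0 (ha0 n), mul_comm]
  · obtain ⟨n, hn⟩ := hDcover x
    exact ⟨a n, ha0 n, mem_iUnion.2 ⟨n, x, hn, rfl⟩⟩

/-- A semicone of finite measure contains almost no full orbit. -/
lemma ae_exists_scaling_notMem {X : Type*} [MeasurableSpace X] {T : ℝ → X → X}
    (hT : IsScaling T) {α : ℝ} (hα : 0 < α) {μ : Measure X} (hhom : HomogeneousMeasure T α μ)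
    {V : Set X} (hVmeas : MeasurableSet V) (hVfin : μ V ≠ ⊤) :
    ∀ᵐ x ∂μ, ∃ t : ℝ, 0 < t ∧ T t x ∉ V := by
  rw [ae_iff]
  refine le_antisymm (ge_of_tendsto (tendsto_ofReal_rpow_neg_mul hα hVfin) ?_) zero_le
  filter_upwards [eventually_gt_atTop 0] with t ht
  rw [← hhom t ht V hVmeas, hT.image_eq_preimage ht]
  refine measure_mono fun x hx => ?_
  by_contra h
  exact hx ⟨t⁻¹, inv_pos.2 ht, h⟩

/-- If almost every orbit spends unit `dt/t`-time in `W`, then `μ` is recovered from its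
restriction to `W` by averaging over the scaling. -/
lemma lintegral_measure_inter_scaling {X : Type*} [MeasurableSpace X] {T : ℝ → X → X}
    (hTmeas : Measurable fun p : X × Set.Ioi (0:ℝ) => T (p.2 : ℝ) p.1)
    {α : ℝ} {μ : Measure X} (hhom : HomogeneousMeasure T α μ)
    {W B : Set X} (hW : MeasurableSet W) (hB : MeasurableSet B) (hBfin : μ B < ⊤)
    (hunit : ∀ᵐ x ∂μ, ∫⁻ t in Set.Ioi (0:ℝ), {t | T t x ∈ W}.indicator
      (fun t => ENNReal.ofReal t⁻¹) t = 1) :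
    ∫⁻ t in Set.Ioi (0:ℝ), μ (T t '' B ∩ W) * ENNReal.ofReal (t ^ (α - 1)) = μ B := by
  have : Fact (μ B < ⊤) := ⟨hBfin⟩
  have : SigmaFinite (Measure.comap (Subtype.val : Set.Ioi (0:ℝ) → ℝ) volume) :=
    SigmaFinite.of_map _ measurable_subtype_coe.aemeasurable (by
      rw [map_comap_subtype_coe measurableSet_Ioi]
      infer_instance)
  have hslice : ∀ t ∈ Set.Ioi (0:ℝ), μ (T t '' B ∩ W) * ENNReal.ofReal (t ^ (α - 1)) =
      ∫⁻ x in B, {t | T t x ∈ W}.indicator (fun t => ENNReal.ofReal t⁻¹) t ∂μ := by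
    intro t (ht : 0 < t)
    have hpre : MeasurableSet (T t ⁻¹' W) := measurable_scaling hTmeas ht hW
    have hrw : ∀ x, {t | T t x ∈ W}.indicator (fun t => ENNReal.ofReal t⁻¹) t =
        (T t ⁻¹' W).indicator (fun _ => ENNReal.ofReal t⁻¹) x := fun x =>
      indicator_congr_of_mem_iff Iff.rfl rfl
    simp_rw [hrw]
    rw [lintegral_indicator_const hpre, Measure.restrict_apply hpre, ← image_inter_preimage,
      hhom t ht _ (hB.inter hpre), mul_right_comm, ← ENNReal.ofReal_mul (by positivity),
      ← Real.rpow_add ht, show -α + (α - 1) = -1 by ring, Real.rpow_neg_one, inter_comm]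
  have hmeas : Measurable fun p : X × Set.Ioi (0:ℝ) =>
      {t | T t p.1 ∈ W}.indicator (fun t => ENNReal.ofReal t⁻¹) (p.2 : ℝ) := by
    have h : Measurable fun p : X × Set.Ioi (0:ℝ) => ENNReal.ofReal (p.2 : ℝ)⁻¹ := by fun_prop
    exact h.indicator (hTmeas hW)
  rw [setLIntegral_congr_fun measurableSet_Ioi hslice,
    ← lintegral_subtype_comap measurableSet_Ioi]
  rw [lintegral_lintegral_swap (f := fun (t : Set.Ioi (0:ℝ)) x =>
    {t | T t x ∈ W}.indicator (fun t => ENNReal.ofReal t⁻¹) (t : ℝ))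
    (hmeas.comp measurable_swap).aemeasurable]
  calc _ = ∫⁻ _ in B, 1 ∂μ := by
        refine lintegral_congr_ae ?_
        filter_upwards [ae_restrict_of_ae hunit] with x hx
        rw [← hx, ← lintegral_subtype_comap measurableSet_Ioi]
    _ = μ B := by simp

/-- representation of α-homogeneous measures via a spectral measure. -/
theorem statement0 {X : Type*} [TopologicalSpace X] [mX : MeasurableSpace X]
    (hmX : mX = baire X)
    (T : ℝ → X → X) (hT : IsScaling T)
    (hTmeas : Measurable fun p : X × Set.Ioi (0:ℝ) => T (p.2 : ℝ) p.1)
    (hfree : ∀ t : ℝ, 0 < t → ∀ x : X, T t x = x → t = 1)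
    (S : Set (Set X)) (hS : IsSetIdeal S) (hcover : ⋃₀ S = Set.univ)
    (D : ℕ → Set X)
    (hDmem : ∀ n, D n ∈ S) (hDbase : ∀ A ∈ S, ∃ n, A ⊆ D n)
    (hDmeas : ∀ n, MeasurableSet (D n))
    (hDsemi : ∀ n, ∀ t : ℝ, 1 ≤ t → T t '' D n ⊆ D n)
    (α : ℝ) (hα : 0 < α)
    (μ : Measure X) (hμ : MemM S μ)
    (hhom : HomogeneousMeasure T α μ) :
    ∃ σ : Measure X, σ Set.univ < ⊤ ∧
      (∀ n, (∫⁻ t in Set.Ioi (0:ℝ), σ (T t '' D n) * ENNReal.ofReal (t ^ (α - 1))) < ⊤) ∧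
      ∀ B ∈ S, MeasurableSet B →
        μ B = ENNReal.ofReal α *
          ∫⁻ t in Set.Ioi (0:ℝ), σ (T t '' B) * ENNReal.ofReal (t ^ (α - 1)) := by
  have hDfin : ∀ n, μ (D n) < ⊤ := fun n => hμ.1 _ (hDmem n) (hDmeas n)
  have hDcover : ∀ x, ∃ n, x ∈ D n := fun x => by
    obtain ⟨A, hA, hx⟩ : x ∈ ⋃₀ S := hcover ▸ mem_univ x
    obtain ⟨n, hn⟩ := hDbase A hA
    exact ⟨n, hn hx⟩
  obtain ⟨V, hVmeas, hVfin, hVsemi, hVabs⟩ := exists_absorbing_semicone hT hTmeas hα hhom hDmeas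
    hDsemi (fun n => (hDfin n).ne) hDcover
  have he : 0 < (Real.exp 1)⁻¹ := inv_pos.2 (Real.exp_pos 1)
  set W : Set X := V \ T (Real.exp 1)⁻¹ ⁻¹' V
  have hWmeas : MeasurableSet W := hVmeas.diff (measurable_scaling hTmeas he hVmeas)
  have hunit : ∀ᵐ x ∂μ, ∫⁻ t in Set.Ioi (0:ℝ), {t | T t x ∈ W}.indicator
      (fun t => ENNReal.ofReal t⁻¹) t = 1 := by
    filter_upwards [ae_exists_scaling_notMem hT hα hhom hVmeas hVfin] with x ⟨u, hu, hxu⟩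
    obtain ⟨v, hv, hxv⟩ := hVabs x
    have hup : ∀ s t, 0 < s → s ≤ t → T s x ∈ V → T t x ∈ V := fun s t hs hst hx => by
      have h := hVsemi (t / s) ((one_le_div hs).2 hst) _ hx
      rwa [hT.2 _ _ (div_pos (hs.trans_le hst) hs) hs, div_mul_cancel₀ _ hs.ne'] at h
    rw [← lintegral_inv_shell hup hu hxu hv hxv]
    refine setLIntegral_congr_fun measurableSet_Ioi fun t (ht : 0 < t) => ?_
    refine indicator_congr_of_mem_iff ?_ rfl
    change (T t x ∈ V ∧ T (Real.exp 1)⁻¹ (T t x) ∉ V) ↔ _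
    rw [hT.2 _ _ he ht, mul_comm]
    rfl
  have hα' : ENNReal.ofReal α ≠ 0 := (ENNReal.ofReal_pos.2 hα).ne'
  set σ : Measure X := (ENNReal.ofReal α)⁻¹ • μ.restrict W
  have hσ : ∀ B ∈ S, MeasurableSet B →
      ∫⁻ t in Set.Ioi (0:ℝ), σ (T t '' B) * ENNReal.ofReal (t ^ (α - 1)) =
        (ENNReal.ofReal α)⁻¹ * μ B := by
    intro B hBS hB
    rw [← lintegral_measure_inter_scaling hTmeas hhom hWmeas hB (hμ.1 B hBS hB) hunit,
      ← lintegral_const_mul' _ _ (ENNReal.inv_ne_top.2 hα')]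
    refine lintegral_congr fun t => ?_
    rw [Measure.smul_apply, Measure.restrict_apply' hWmeas, smul_eq_mul, mul_assoc]
  refine ⟨σ, ?_, fun n => ?_, fun B hBS hB => ?_⟩
  · rw [Measure.smul_apply, Measure.restrict_apply_univ, smul_eq_mul]
    exact ENNReal.mul_lt_top (ENNReal.inv_lt_top.2 (ENNReal.ofReal_pos.2 hα))
      ((measure_mono sdiff_subset).trans_lt hVfin.lt_top)
  · rw [hσ _ (hDmem n) (hDmeas n)]
    exact ENNReal.mul_lt_top (ENNReal.inv_lt_top.2 (ENNReal.ofReal_pos.2 hα)) (hDfin n)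
  · rw [hσ B hBS hB, ← mul_assoc, ENNReal.mul_inv_cancel hα' ENNReal.ofReal_ne_top, one_mul]
end
end

section
/- Let X be a topological space equipped with a continuous scaling T and the ideal S_τ generated by a continuous proper modulus τ (proper: τ(x) ∈ (0, ∞) for every x ∈ X that is not scaling invariant, i.e. with T_t x ≠ x for all t ≠ 1). Let ℓ : X → [0, ∞) be another continuous modulus such that, whenever τ(x_γ) → 0 along a net, also ℓ(x_γ) → 0. Let ξ be a Baire random element of X with ξ ∈ RV(X, T, S_τ, g, μ), and assume ℓ does not vanish μ-almost everywhere. Then: {ℓ > s} ∈ S_τ for every s > 0; there is α > 0 with g ∈ RV_α such that g(t)·P(ℓ(ξ) > st) → μ({ℓ > 1})·s^{−α} for every s > 0 (i.e. ℓ(ξ) ∈ RV(ℝ₊, ·, R₀, g, cθ_α) with c = μ({ℓ > 1}) ∈ (0, ∞)); and the conditional laws of T_{t⁻¹}ξ given ℓ(ξ) > t converge weakly as t → ∞ to μ(· ∩ {ℓ > 1})/μ({ℓ > 1}), i.e. for every bounded continuous f : X → ℝ, E[f(T_{t⁻¹}ξ)·1{ℓ(ξ) > t}]/P(ℓ(ξ)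 > t) → (1/μ({ℓ>1})) ∫_{{ℓ>1}} f dμ. -/
open MeasureTheory Filter Topology Set
open scoped ENNReal NNReal

noncomputable section

theorem exists_rpow_of_mul {ψ : ℝ → ℝ} (hpos : ∀ x, 0 < x → 0 < ψ x)
    (hmul : ∀ x y, 0 < x → 0 < y → ψ (x * y) = ψ x * ψ y)
    (hle : ∀ x, 0 < x → x ≤ 1 → ψ x ≤ 1) :
    ∃ α : ℝ, ∀ x, 0 < x → ψ x = x ^ α := by
  let L : ℝ →+ ℝ := AddMonoidHom.mk' (fun y => Real.log (ψ (Real.exp y))) (by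
    intro a b
    rw [Real.exp_add, hmul _ _ (Real.exp_pos a) (Real.exp_pos b),
      Real.log_mul (hpos _ (Real.exp_pos a)).ne' (hpos _ (Real.exp_pos b)).ne'])
  have hmono : Monotone L := by
    intro a b hab
    have h : L (a - b) ≤ 0 :=
      Real.log_nonpos (hpos _ (Real.exp_pos _)).le
        (hle _ (Real.exp_pos _) (Real.exp_le_one_iff.2 (sub_nonpos.2 hab)))
    rw [map_sub] at h
    linarith
  have hc : Continuous L := Measure.AddMonoidHom.continuous_of_measurable L hmono.measurable
  refine ⟨L 1, fun x hx => ?_⟩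
  have h := map_real_smul L hc (Real.log x) 1
  simp only [smul_eq_mul, mul_one] at h
  have h2 : L (Real.log x) = Real.log (ψ x) := by
    change Real.log (ψ (Real.exp (Real.log x))) = _
    rw [Real.exp_log hx]
  rw [Real.rpow_def_of_pos hx, ← h, h2, Real.exp_log (hpos x hx)]

theorem tendsto_mul_const_atTop {x : ℝ} (hx : 0 < x) :
    Tendsto (fun t : ℝ => x * t) atTop atTop :=
  tendsto_id.const_mul_atTop hx

theorem RegVary.tendsto_mul_comp {g H : ℝ → ℝ} {α a x : ℝ} (hg : RegVary g α)
    (hpos : ∀ t : ℝ, 0 < t → 0 < g t)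
    (hH : Tendsto (fun t => g t * H t) atTop (𝓝 a)) (hx : 0 < x) :
    Tendsto (fun t => g t * H (x * t)) atTop (𝓝 (a * x ^ (-α))) := by
  have h1 := hH.comp (tendsto_mul_const_atTop hx)
  have h2 := (hg x hx).inv₀ (Real.rpow_pos_of_pos hx α).ne'
  rw [Real.rpow_neg hx.le]
  refine (h1.mul h2).congr' ?_
  filter_upwards [eventually_gt_atTop 0] with t ht
  have := hpos _ ht
  have := hpos _ (mul_pos hx ht)
  simp only [Function.comp]
  field_simp

theorem exists_regVary {g H A : ℝ → ℝ} {x₀ : ℝ} (hpos : ∀ t : ℝ, 0 < t → 0 < g t)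
    (hH : ∀ x, 0 < x → Tendsto (fun t => g t * H (x * t)) atTop (𝓝 (A x)))
    (hA : AntitoneOn A (Ioi 0)) (hA0 : Tendsto A atTop (𝓝 0))
    (hx₀ : 0 < x₀) (hAx₀ : 0 < A x₀) :
    ∃ α : ℝ, 0 < α ∧ RegVary g α := by
  have hsmall : ∀ x, 0 < x → x ≤ 1 → 0 < A (x₀ * x) ∧
      Tendsto (fun t => g (x * t) / g t) atTop (𝓝 (A x₀ / A (x₀ * x))) := by
    intro x hx hx1
    have hxx : 0 < x₀ * x := mul_pos hx₀ hx
    have hle : A x₀ ≤ A (x₀ * x) := hA hxx hx₀ (by nlinarith)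
    have hp : 0 < A (x₀ * x) := hAx₀.trans_le hle
    refine ⟨hp, ?_⟩
    have h1 := (hH x₀ hx₀).comp (tendsto_mul_const_atTop hx)
    have h2 := hH _ hxx
    refine (h1.div h2 hp.ne').congr' ?_
    filter_upwards [eventually_gt_atTop 0, h2.eventually_ne hp.ne'] with t ht hne
    have hH' : H (x₀ * x * t) ≠ 0 := right_ne_zero_of_mul hne
    simp only [Function.comp, Pi.div_apply, ← mul_assoc]
    rw [mul_div_mul_right _ _ hH']
  have hlim : ∀ x, 0 < x → ∃ c, 0 < c ∧ Tendsto (fun t => g (x * t) / g t) atTop (𝓝 c) := by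
    intro x hx
    rcases le_total x 1 with hx1 | hx1
    · exact ⟨_, div_pos hAx₀ (hsmall x hx hx1).1, (hsmall x hx hx1).2⟩
    · obtain ⟨hp, ht⟩ := hsmall x⁻¹ (inv_pos.2 hx) (inv_le_one_of_one_le₀ hx1)
      refine ⟨_, inv_pos.2 (div_pos hAx₀ hp),
        ((ht.inv₀ (div_pos hAx₀ hp).ne').comp (tendsto_mul_const_atTop hx)).congr fun t => ?_⟩
      simp only [Function.comp, inv_div, inv_mul_cancel_left₀ hx.ne']
  choose! ψ hψpos hψ using hlim
  obtain ⟨α, hα⟩ := exists_rpow_of_mul hψpos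
    (fun x y hx hy => by
      refine tendsto_nhds_unique (hψ _ (mul_pos hx hy))
        ((((hψ x hx).comp (tendsto_mul_const_atTop hy)).mul (hψ y hy)).congr' ?_)
      filter_upwards [eventually_gt_atTop 0] with t ht
      have := hpos _ ht
      have := hpos _ (mul_pos hy ht)
      simp only [Function.comp, ← mul_assoc]
      field_simp)
    (fun x hx hx1 => by
      obtain ⟨hp, ht⟩ := hsmall x hx hx1
      rw [tendsto_nhds_unique (hψ x hx) ht, div_le_one hp]
      exact hA (mul_pos hx₀ hx) hx₀ (by nlinarith))
  have hreg : RegVary g α := fun x hx => hα x hx ▸ hψ x hx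
  refine ⟨α, ?_, hreg⟩
  by_contra hneg
  have hge : ∀ᶠ y in atTop, A x₀ ≤ A y := by
    filter_upwards [eventually_ge_atTop x₀] with y hy
    have hy0 : 0 < y := hx₀.trans_le hy
    have hyx : 1 ≤ y / x₀ := (one_le_div hx₀).2 hy
    have h := hreg.tendsto_mul_comp hpos (hH x₀ hx₀) (H := fun t => H (x₀ * t))
      (div_pos hy0 hx₀)
    have heq : A y = A x₀ * (y / x₀) ^ (-α) := by
      refine tendsto_nhds_unique (hH y hy0) (h.congr fun t => ?_)
      rw [← mul_assoc, mul_div_cancel₀ _ hx₀.ne']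
    rw [heq]
    exact le_mul_of_one_le_right hAx₀.le (Real.one_le_rpow hyx (by linarith))
  exact absurd (ge_of_tendsto hA0 hge) (not_le.2 hAx₀)

theorem tendsto_of_forall_approx {ι : Type*} {l : Filter ι} {u : ι → ℝ} {a : ℝ}
    (h : ∀ ε : ℝ, 0 < ε → ∃ (v E : ι → ℝ) (b e : ℝ), Tendsto v l (𝓝 b) ∧ Tendsto E l (𝓝 e) ∧
      e < ε ∧ (∀ᶠ i in l, |u i - v i| ≤ E i) ∧ |a - b| ≤ e) :
    Tendsto u l (𝓝 a) := by
  rw [Metric.tendsto_nhds]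
  intro ε hε
  obtain ⟨v, E, b, e, hv, hE, he, huv, hab⟩ := h (ε / 3) (by positivity)
  filter_upwards [Metric.tendsto_nhds.1 hv (ε / 3) (by positivity), hE.eventually_lt_const he,
    huv] with i h1 h2 h3
  rw [Real.dist_eq] at h1 ⊢
  rw [abs_le] at h3 hab
  rw [abs_lt] at h1 ⊢
  constructor <;> linarith [h3.1, h3.2, hab.1, hab.2, h1.1, h1.2]

/-- The continuous function which is `0` on `(-∞, 1]`, `1` on `[q, ∞)` and affine between. -/
def ramp (q u : ℝ) : ℝ := max 0 (min 1 ((u - 1) / (q - 1)))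

theorem continuous_ramp (q : ℝ) : Continuous (ramp q) := by
  unfold ramp
  fun_prop

theorem ramp_nonneg (q u : ℝ) : 0 ≤ ramp q u := le_max_left _ _

theorem ramp_le_one (q u : ℝ) : ramp q u ≤ 1 := max_le zero_le_one (min_le_left _ _)

theorem abs_ramp_le_one (q u : ℝ) : |ramp q u| ≤ 1 :=
  abs_le.2 ⟨by linarith [ramp_nonneg q u], ramp_le_one q u⟩

theorem ramp_mono {q : ℝ} (hq : 1 < q) : Monotone (ramp q) := by
  intro u v huv
  have : 0 < q - 1 := sub_pos.2 hq
  unfold ramp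
  gcongr

theorem ramp_eq_zero {q u : ℝ} (hq : 1 < q) (hu : u ≤ 1) : ramp q u = 0 :=
  max_eq_left ((min_le_right _ _).trans
    (div_nonpos_of_nonpos_of_nonneg (by linarith) (by linarith)))

theorem ramp_eq_one {q u : ℝ} (hq : 1 < q) (hu : q ≤ u) : ramp q u = 1 := by
  have : 1 ≤ (u - 1) / (q - 1) := (one_le_div (by linarith)).2 (by linarith)
  simp [ramp, this]

theorem ramp_pos {q u : ℝ} (hq : 1 < q) (hu : 1 < u) : 0 < ramp q u :=
  lt_max_of_lt_right (lt_min one_pos (div_pos (by linarith) (by linarith)))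

section Sandwich

variable {X : Type*} [MeasurableSpace X] {m : Measure X} {ℓ : X → ℝ}

theorem integrable_of_bounded_of_support {h : X → ℝ} {s C : ℝ}
    (hfin : m {x | s < ℓ x} < ⊤) (hh : Measurable h) (hC : ∀ x, |h x| ≤ C)
    (hs : ∀ x, ℓ x ≤ s → h x = 0) : Integrable h m := by
  have hsub : Function.support h ⊆ {x | s < ℓ x} := fun x hx =>
    not_le.1 fun hle => hx (hs x hle)
  rw [← integrableOn_iff_integrable_of_support_subset hsub]
  exact Measure.integrableOn_of_bounded hfin.ne hh.aestronglyMeasurable (M := C)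
    (Eventually.of_forall hC)

theorem integrable_ramp_mul {f : X → ℝ} {q y C : ℝ} (hℓ : Measurable ℓ)
    (hfin : ∀ s : ℝ, 0 < s → m {x | s < ℓ x} < ⊤) (hf : Measurable f) (hC : ∀ x, |f x| ≤ C)
    (hq : 1 < q) (hy : 0 < y) : Integrable (fun x => ramp q (y * ℓ x) * f x) m := by
  refine integrable_of_bounded_of_support (hfin y⁻¹ (inv_pos.2 hy)) (C := C)
    (((continuous_ramp q).measurable.comp (hℓ.const_mul y)).mul hf) (fun x => ?_)
    (fun x hx => ?_)
  · rw [abs_mul]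
    calc _ ≤ 1 * |f x| := by gcongr; exact abs_ramp_le_one _ _
      _ ≤ C := by rw [one_mul]; exact hC x
  · rw [ramp_eq_zero hq, zero_mul]
    calc y * ℓ x ≤ y * y⁻¹ := by gcongr
      _ = 1 := mul_inv_cancel₀ hy.ne'

theorem integrable_ramp {q y : ℝ} (hℓ : Measurable ℓ)
    (hfin : ∀ s : ℝ, 0 < s → m {x | s < ℓ x} < ⊤)
    (hq : 1 < q) (hy : 0 < y) : Integrable (fun x => ramp q (y * ℓ x)) m := by
  simpa using integrable_ramp_mul (f := fun _ => 1) (C := 1) hℓ hfin measurable_const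
    (by simp) hq hy

theorem abs_setIntegral_sub_ramp_le {f : X → ℝ} {q C : ℝ} (hℓ : Measurable ℓ)
    (hfin : ∀ s : ℝ, 0 < s → m {x | s < ℓ x} < ⊤) (hf : Measurable f) (hC : ∀ x, |f x| ≤ C)
    (hq : 1 < q) :
    |∫ x in {x | 1 < ℓ x}, f x ∂m - ∫ x, ramp q (ℓ x) * f x ∂m| ≤
      C * (∫ x, ramp q (q * ℓ x) ∂m - ∫ x, ramp q (ℓ x) ∂m) := by
  have hS : MeasurableSet {x | 1 < ℓ x} := measurableSet_lt measurable_const hℓ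
  have hq0 : 0 < q := one_pos.trans hq
  have i1 := integrable_ramp_mul hℓ hfin hf hC hq one_pos
  have i2 := integrable_ramp hℓ hfin hq hq0
  have i3 := integrable_ramp hℓ hfin hq one_pos
  simp only [one_mul] at i1 i3
  have i0 : Integrable ({x | 1 < ℓ x}.indicator f) m := by
    refine integrable_of_bounded_of_support (hfin 1 one_pos) (hf.indicator hS) (C := C)
      (fun x => ?_) (fun x hx => indicator_of_notMem (s := {x | 1 < ℓ x}) (not_lt.2 hx) f)
    exact (norm_indicator_le_norm_self f x).trans (hC x)
  rw [← integral_indicator hS, ← integral_sub i0 i1, ← integral_sub i2 i3, ← integral_const_mul]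
  refine (abs_integral_le_integral_abs).trans
    (integral_mono (i0.sub i1).abs ((i2.sub i3).const_mul C) fun x => ?_)
  have hC0 : 0 ≤ C := (abs_nonneg _).trans (hC x)
  rcases le_or_gt (ℓ x) 1 with hx | hx
  · have h1 : x ∉ {x | 1 < ℓ x} := not_lt.2 hx
    simp only [indicator_of_notMem h1, ramp_eq_zero hq hx, zero_mul, sub_zero, abs_zero]
    exact mul_nonneg hC0 (ramp_nonneg _ _)
  · have h1 : x ∈ {x | 1 < ℓ x} := hx
    have h2 : f x - ramp q (ℓ x) * f x = (1 - ramp q (ℓ x)) * f x := by ring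
    have h3 : 0 ≤ 1 - ramp q (ℓ x) := sub_nonneg.2 (ramp_le_one _ _)
    simp only [indicator_of_mem h1, ramp_eq_one hq (le_mul_of_one_le_right hq0.le hx.le)]
    rw [h2, abs_mul, abs_of_nonneg h3, mul_comm C]
    gcongr
    exact hC x

theorem integral_ramp_le {q : ℝ} (hℓ : Measurable ℓ)
    (hfin : ∀ s : ℝ, 0 < s → m {x | s < ℓ x} < ⊤) (hq : 1 < q) :
    ∫ x, ramp q (ℓ x) ∂m ≤ (m {x | 1 < ℓ x}).toReal := by
  have hS : MeasurableSet {x | 1 < ℓ x} := measurableSet_lt measurable_const hℓ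
  have i := integrable_ramp hℓ hfin hq one_pos
  simp only [one_mul] at i
  rw [← measureReal_def, ← integral_indicator_one hS]
  refine integral_mono i ((integrable_indicator_iff hS).2
    (integrableOn_const (hfin 1 one_pos).ne)) fun x => ?_
  rcases le_or_gt (ℓ x) 1 with hx | hx
  · simp only [ramp_eq_zero hq hx]
    exact indicator_nonneg (fun _ _ => zero_le_one) x
  · have h1 : x ∈ {x | 1 < ℓ x} := hx
    simp only [indicator_of_mem h1]
    exact ramp_le_one _ _

theorem antitoneOn_integral_ramp {q : ℝ} (hℓ : Measurable ℓ) (h0 : ∀ x, 0 ≤ ℓ x)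
    (hfin : ∀ s : ℝ, 0 < s → m {x | s < ℓ x} < ⊤) (hq : 1 < q) :
    AntitoneOn (fun y => ∫ x, ramp q (y⁻¹ * ℓ x) ∂m) (Ioi 0) := by
  intro y hy z hz hyz
  have hy : 0 < y := hy
  exact integral_mono (integrable_ramp hℓ hfin hq (inv_pos.2 hz))
    (integrable_ramp hℓ hfin hq (inv_pos.2 hy)) fun x =>
      ramp_mono hq (mul_le_mul_of_nonneg_right (inv_anti₀ hy hyz) (h0 x))

theorem tendsto_integral_ramp {q : ℝ} (hℓ : Measurable ℓ) (h0 : ∀ x, 0 ≤ ℓ x)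
    (hfin : ∀ s : ℝ, 0 < s → m {x | s < ℓ x} < ⊤) (hq : 1 < q) :
    Tendsto (fun y => ∫ x, ramp q (y⁻¹ * ℓ x) ∂m) atTop (𝓝 0) := by
  have h : Tendsto (fun y => ∫ x, ramp q (y⁻¹ * ℓ x) ∂m) atTop (𝓝 (∫ _, (0 : ℝ) ∂m)) := by
    refine tendsto_integral_filter_of_dominated_convergence (fun x => ramp q (1 * ℓ x))
      (Eventually.of_forall fun y => ((continuous_ramp q).measurable.comp
        (hℓ.const_mul y⁻¹)).aestronglyMeasurable) ?_ (integrable_ramp hℓ hfin hq one_pos)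
      (Eventually.of_forall fun x => ?_)
    · filter_upwards [eventually_ge_atTop 1] with y hy
      refine Eventually.of_forall fun x => ?_
      rw [Real.norm_of_nonneg (ramp_nonneg _ _)]
      exact ramp_mono hq (mul_le_mul_of_nonneg_right (inv_le_one_of_one_le₀ hy) (h0 x))
    · refine tendsto_const_nhds.congr' ?_
      filter_upwards [eventually_gt_atTop 0, eventually_ge_atTop (ℓ x)] with y hy hxy
      refine (ramp_eq_zero hq ?_).symm
      rwa [inv_mul_le_iff₀ hy, mul_one]
  simpa using h

theorem exists_integral_ramp_pos {q : ℝ} (hℓ : Measurable ℓ) (h0 : ∀ x, 0 ≤ ℓ x)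
    (hfin : ∀ s : ℝ, 0 < s → m {x | s < ℓ x} < ⊤) (hq : 1 < q)
    (hne : m {x | ℓ x ≠ 0} ≠ 0) :
    ∃ y : ℝ, 0 < y ∧ 0 < ∫ x, ramp q (y⁻¹ * ℓ x) ∂m := by
  by_contra! hcon
  refine hne (measure_mono_null (t := ⋃ n : ℕ, {x | ((n : ℝ) + 1)⁻¹ < ℓ x}) (fun x hx => ?_)
    (measure_iUnion_null fun n => ?_))
  · obtain ⟨n, hn⟩ := exists_nat_one_div_lt ((h0 x).lt_of_ne' hx)
    exact mem_iUnion.2 ⟨n, by simpa using hn⟩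
  · have hy : (0 : ℝ) < ((n : ℝ) + 1)⁻¹ := by positivity
    by_contra hpos
    refine (hcon _ hy).not_gt ((integral_pos_iff_support_of_nonneg
      (fun x => ramp_nonneg _ _) (integrable_ramp hℓ hfin hq (inv_pos.2 hy))).2
      ((pos_iff_ne_zero.2 hpos).trans_le (measure_mono fun x hx => ?_)))
    refine (ramp_pos hq ?_).ne'
    rwa [lt_inv_mul_iff₀ hy, mul_one]

end Sandwich

theorem Continuous.measurable_baire {X : Type*} [TopologicalSpace X] [mX : MeasurableSpace X]
    (hX : mX = baire X) {f : X → ℝ} (hf : Continuous f) : Measurable f := by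
  subst hX
  refine Measurable.mono (ma := MeasurableSpace.comap f (borel ℝ)) ?_
    (le_iSup (fun f : { g : X → ℝ // Continuous g } => MeasurableSpace.comap f.1 (borel ℝ))
      ⟨f, hf⟩) (BorelSpace.measurable_eq (α := ℝ)).le
  exact comap_measurable f

theorem measurable_baire_of_continuous {X : Type*} [TopologicalSpace X] [mX : MeasurableSpace X]
    (hX : mX = baire X) {F : X → X} (hF : Continuous F) : Measurable F := by
  subst hX
  rw [measurable_iff_comap_le]
  conv_lhs => rw [baire]
  rw [MeasurableSpace.comap_iSup]
  refine iSup_le fun f => ?_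
  rw [MeasurableSpace.comap_comp]
  exact le_iSup (fun f : { g : X → ℝ // Continuous g } => MeasurableSpace.comap f.1 (borel ℝ))
    ⟨f.1 ∘ F, f.2.comp hF⟩

theorem ContinuousScaling.continuous {X : Type*} [TopologicalSpace X] {T : ℝ → X → X}
    (hT : ContinuousScaling T) {t : ℝ} (ht : 0 < t) : Continuous (T t) :=
  hT.comp_continuous (f := fun x => (t, x)) (by fun_prop) fun _ => ⟨ht, mem_univ _⟩

theorem setOf_lt_mem_SIdealE {X : Type*} {τ : X → ℝ≥0∞} {ℓ : X → ℝ}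
    (h : ∀ l : Filter X, Tendsto τ l (𝓝 0) → Tendsto ℓ l (𝓝 0)) {s : ℝ} (hs : 0 < s) :
    {x | s < ℓ x} ∈ SIdealE τ := by
  have h1 := (h (comap τ (𝓝 0)) tendsto_comap).eventually_lt_const hs
  obtain ⟨U, hU, hsub⟩ := h1
  obtain ⟨ε, hε, hεU⟩ := ENNReal.nhds_zero_basis.mem_iff.1 hU
  refine ⟨ε, hε, fun x hx => not_lt.1 fun hlt => ?_⟩
  exact lt_asymm (show s < ℓ x from hx) (hsub (hεU hlt))

theorem exists_one_lt_mul_rpow_sub_one_lt {α C M ε : ℝ} (hε : 0 < ε) :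
    ∃ q : ℝ, 1 < q ∧ C * ((q ^ α - 1) * M) < ε := by
  have hc : ContinuousAt (fun q : ℝ => C * ((q ^ α - 1) * M)) 1 := by
    refine continuousAt_const.mul (((Real.continuousAt_rpow_const 1 α (Or.inl one_ne_zero)).sub
      continuousAt_const).mul continuousAt_const)
  have h : ∀ᶠ q in 𝓝[>] (1 : ℝ), C * ((q ^ α - 1) * M) < ε :=
    (hc.tendsto.eventually_lt_const (by simpa using hε)).filter_mono nhdsWithin_le_nhds
  obtain ⟨q, hq, hq1⟩ := (h.and self_mem_nhdsWithin).exists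
  exact ⟨q, hq1, hq⟩

/-- changing the reference modulus (Theorem of Dombry–Ribatet type). -/
theorem statement5 {X : Type*} [TopologicalSpace X] [mX : MeasurableSpace X]
    (hmX : mX = baire X)
    (T : ℝ → X → X) (hT : IsScaling T) (hTc : ContinuousScaling T)
    (τ : X → ℝ≥0∞) (hτc : Continuous τ) (hτm : IsModulusE T τ)
    (hτproper : ∀ x : X, (∀ t : ℝ, 0 < t → t ≠ 1 → T t x ≠ x) → 0 < τ x ∧ τ x < ⊤)
    (ℓ : X → ℝ) (hℓc : Continuous ℓ) (hℓm : IsModulus T ℓ)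
    (hℓτ : ∀ l : Filter X, Tendsto τ l (𝓝 0) → Tendsto ℓ l (𝓝 0))
    {Ω : Type*} [MeasurableSpace Ω] (P : Measure Ω) [IsProbabilityMeasure P]
    (ξ : Ω → X) (hξ : Measurable ξ)
    (g : ℝ → ℝ) (μ : Measure X)
    (hRV : MeasureRV T (SIdealE τ) g (Measure.map ξ P) μ)
    (hℓμ : μ {x | ℓ x ≠ 0} ≠ 0) :
    (∀ s : ℝ, 0 < s → {x | s < ℓ x} ∈ SIdealE τ) ∧
    (0 < μ {x | 1 < ℓ x} ∧ μ {x | 1 < ℓ x} < ⊤) ∧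
    (∃ α : ℝ, 0 < α ∧ RegVary g α ∧
      ∀ s : ℝ, 0 < s →
        Tendsto (fun t : ℝ => g t * (P {ω | s * t < ℓ (ξ ω)}).toReal) atTop
          (𝓝 ((μ {x | 1 < ℓ x}).toReal * s ^ (-α)))) ∧
    (∀ f : X → ℝ, Continuous f → (∃ C : ℝ, ∀ x, |f x| ≤ C) →
      Tendsto (fun t : ℝ =>
          (∫ ω in {ω | t < ℓ (ξ ω)}, f (T t⁻¹ (ξ ω)) ∂P) /
            (P {ω | t < ℓ (ξ ω)}).toReal)
        atTop
        (𝓝 ((μ {x | 1 < ℓ x}).toReal⁻¹ * ∫ x in {x | 1 < ℓ x}, f x ∂μ))) := by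
  have hmeas : ∀ {f : X → ℝ}, Continuous f → Measurable f := fun hf => hf.measurable_baire hmX
  obtain ⟨-, gpos, -, hM, -, hconv⟩ := hRV
  have hS : ∀ s : ℝ, 0 < s → {x | s < ℓ x} ∈ SIdealE τ := fun s hs => setOf_lt_mem_SIdealE hℓτ hs
  have hℓmeas : Measurable ℓ := hmeas hℓc
  have hfin : ∀ s : ℝ, 0 < s → μ {x | s < ℓ x} < ⊤ := fun s hs =>
    hM.1 _ (hS s hs) (measurableSet_lt measurable_const hℓmeas)
  have hTξ : ∀ t : ℝ, 0 < t → Measurable (fun ω => T t⁻¹ (ξ ω)) := fun t ht =>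
    (measurable_baire_of_continuous hmX (hTc.continuous (inv_pos.2 ht))).comp hξ
  have hmap : ∀ {η : Ω → X} {h : X → ℝ}, Measurable η → Continuous h →
      ∫ x, h x ∂(P.map η) = ∫ ω, h (η ω) ∂P := fun hη hh =>
    integral_map hη.aemeasurable (hmeas hh).aestronglyMeasurable
  have hramp : ∀ q y : ℝ, 1 < q → 0 < y → ∀ f : X → ℝ, Continuous f →
      (∃ C : ℝ, ∀ x, |f x| ≤ C) →
      Tendsto (fun t : ℝ => g t * ∫ ω, ramp q (y * (t⁻¹ * ℓ (ξ ω))) * f (T t⁻¹ (ξ ω)) ∂P) atTop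
        (𝓝 (∫ x, ramp q (y * ℓ x) * f x ∂μ)) := by
    rintro q y hq hy f hf ⟨C, hC⟩
    have hcont : Continuous fun x => ramp q (y * ℓ x) * f x :=
      ((continuous_ramp q).comp (by fun_prop)).mul hf
    have htest : TestFun (SIdealE τ) fun x => ramp q (y * ℓ x) * f x := by
      refine ⟨hcont, ⟨C, fun x => ?_⟩, ?_⟩
      · rw [abs_mul]
        calc _ ≤ 1 * |f x| := by gcongr; exact abs_ramp_le_one _ _
          _ ≤ C := by rw [one_mul]; exact hC x
      · obtain ⟨ε, hε, h⟩ := hS y⁻¹ (inv_pos.2 hy)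
        refine ⟨ε, hε, fun x hx => h x ?_⟩
        by_contra hle
        refine hx ?_
        have hle : ℓ x ≤ y⁻¹ := not_lt.1 hle
        change ramp q (y * ℓ x) * f x = 0
        rw [ramp_eq_zero hq, zero_mul]
        calc y * ℓ x ≤ y * y⁻¹ := by gcongr
          _ = 1 := mul_inv_cancel₀ hy.ne'
    refine (hconv _ htest).congr' ?_
    filter_upwards [eventually_gt_atTop 0] with t ht
    rw [hmap hξ (h := fun x => ramp q (y * ℓ (T t⁻¹ x)) * f (T t⁻¹ x))
      (hcont.comp (hTc.continuous (inv_pos.2 ht)))]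
    simp only [hℓm.2 t⁻¹ (inv_pos.2 ht)]
  have hramp1 : ∀ q y : ℝ, 1 < q → 0 < y →
      Tendsto (fun t : ℝ => g t * ∫ ω, ramp q (y * (t⁻¹ * ℓ (ξ ω))) ∂P) atTop
        (𝓝 (∫ x, ramp q (y * ℓ x) ∂μ)) := fun q y hq hy => by
    simpa using hramp q y hq hy (fun _ => 1) continuous_const ⟨1, by simp⟩
  have hH : ∀ q x : ℝ, 1 < q → 0 < x →
      Tendsto (fun t : ℝ => g t * ∫ ω, ramp q ((x * t)⁻¹ * ℓ (ξ ω)) ∂P) atTop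
        (𝓝 (∫ z, ramp q (x⁻¹ * ℓ z) ∂μ)) := fun q x hq hx => by
    simpa only [mul_inv, mul_assoc] using hramp1 q x⁻¹ hq (inv_pos.2 hx)
  obtain ⟨x₀, hx₀, hAx₀⟩ := exists_integral_ramp_pos hℓmeas hℓm.1 hfin one_lt_two hℓμ
  obtain ⟨α, hα, hreg⟩ := exists_regVary (H := fun t => ∫ ω, ramp 2 (t⁻¹ * ℓ (ξ ω)) ∂P) gpos
    (fun x hx => hH 2 x one_lt_two hx)
    (antitoneOn_integral_ramp hℓmeas hℓm.1 hfin one_lt_two)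
    (tendsto_integral_ramp hℓmeas hℓm.1 hfin one_lt_two) hx₀ hAx₀
  have hscale : ∀ q x : ℝ, 1 < q → 0 < x →
      ∫ z, ramp q (x⁻¹ * ℓ z) ∂μ = (∫ z, ramp q (ℓ z) ∂μ) * x ^ (-α) := fun q x hq hx => by
    refine tendsto_nhds_unique (hH q x hq hx)
      (hreg.tendsto_mul_comp (H := fun t => ∫ ω, ramp q (t⁻¹ * ℓ (ξ ω)) ∂P) gpos ?_ hx)
    simpa using hramp1 q 1 hq one_pos
  have hμpos : 0 < (μ {x | 1 < ℓ x}).toReal := by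
    rw [hscale 2 x₀ one_lt_two hx₀] at hAx₀
    exact (pos_of_mul_pos_left hAx₀ (Real.rpow_nonneg hx₀.le _)).trans_le
      (integral_ramp_le hℓmeas hfin one_lt_two)
  have hmain : ∀ f : X → ℝ, Continuous f → (∃ C : ℝ, ∀ x, |f x| ≤ C) →
      Tendsto (fun t : ℝ => g t * ∫ ω in {ω | t < ℓ (ξ ω)}, f (T t⁻¹ (ξ ω)) ∂P) atTop
        (𝓝 (∫ x in {x | 1 < ℓ x}, f x ∂μ)) := by
    rintro f hf ⟨C, hC⟩
    refine tendsto_of_forall_approx fun ε hε => ?_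
    obtain ⟨q, hq, hqε⟩ :=
      exists_one_lt_mul_rpow_sub_one_lt (α := α) (C := |C|) (M := (μ {x | 1 < ℓ x}).toReal) hε
    have hq0 : 0 < q := one_pos.trans hq
    have hC' : ∀ x, |f x| ≤ |C| := fun x => (hC x).trans (le_abs_self C)
    refine ⟨_, _, _, _, hramp q 1 hq one_pos f hf ⟨C, hC⟩,
      ((hramp1 q q hq hq0).sub (hramp1 q 1 hq one_pos)).const_mul |C|, ?_, ?_, ?_⟩
    · refine lt_of_le_of_lt ?_ hqε
      have h := hscale q q⁻¹ hq (inv_pos.2 hq0)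
      rw [inv_inv, Real.inv_rpow hq0.le, ← Real.rpow_neg hq0.le, neg_neg] at h
      have h1 := integral_ramp_le (m := μ) hℓmeas hfin hq
      have h2 : 1 ≤ q ^ α := Real.one_le_rpow hq.le hα.le
      simp only [one_mul]
      rw [h]
      refine mul_le_mul_of_nonneg_left ?_ (abs_nonneg C)
      calc _ = (q ^ α - 1) * ∫ z, ramp q (ℓ z) ∂μ := by ring
        _ ≤ _ := mul_le_mul_of_nonneg_left h1 (sub_nonneg.2 h2)
    · filter_upwards [eventually_gt_atTop 0] with t ht
      have hp : IsProbabilityMeasure (P.map fun ω => T t⁻¹ (ξ ω)) :=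
        Measure.isProbabilityMeasure_map (hTξ t ht).aemeasurable
      have h := abs_setIntegral_sub_ramp_le (m := P.map fun ω => T t⁻¹ (ξ ω)) hℓmeas
        (fun s _ => measure_lt_top _ _) (hmeas hf) hC' hq
      have hcr₁ : Continuous fun x => ramp q (ℓ x) * f x := ((continuous_ramp q).comp hℓc).mul hf
      have hcr₂ : Continuous fun x => ramp q (q * ℓ x) :=
        (continuous_ramp q).comp (continuous_const.mul hℓc)
      have hcr₃ : Continuous fun x => ramp q (ℓ x) := (continuous_ramp q).comp hℓc
      rw [setIntegral_map (measurableSet_lt measurable_const hℓmeas)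
        (hmeas hf).aestronglyMeasurable (hTξ t ht).aemeasurable,
        hmap (hTξ t ht) hcr₁, hmap (hTξ t ht) hcr₂, hmap (hTξ t ht) hcr₃] at h
      have hset : (fun ω => T t⁻¹ (ξ ω)) ⁻¹' {x | 1 < ℓ x} = {ω | t < ℓ (ξ ω)} := by
        ext ω
        simp only [mem_preimage, mem_ofPred_eq, hℓm.2 t⁻¹ (inv_pos.2 ht), lt_inv_mul_iff₀ ht,
          mul_one]
      rw [hset] at h
      simp only [hℓm.2 t⁻¹ (inv_pos.2 ht)] at h
      have hgt := gpos t ht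
      simp only [one_mul]
      rw [← mul_sub, ← mul_sub, abs_mul, abs_of_pos hgt, mul_left_comm]
      exact mul_le_mul_of_nonneg_left h hgt.le
    · simpa only [one_mul] using
        abs_setIntegral_sub_ramp_le hℓmeas hfin (hmeas hf) hC' hq
  have hprob : Tendsto (fun t : ℝ => g t * (P {ω | t < ℓ (ξ ω)}).toReal) atTop
      (𝓝 (μ {x | 1 < ℓ x}).toReal) := by
    simpa [measureReal_def] using hmain (fun _ => 1) continuous_const ⟨1, by simp⟩
  refine ⟨hS, ⟨(ENNReal.toReal_pos_iff.1 hμpos).1, hfin 1 one_pos⟩, ⟨α, hα, hreg, fun s hs =>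
    hreg.tendsto_mul_comp (H := fun t => (P {ω | t < ℓ (ξ ω)}).toReal) gpos hprob hs⟩,
    fun f hf hb => ?_⟩
  rw [inv_mul_eq_div]
  refine ((hmain f hf hb).div hprob hμpos.ne').congr' ?_
  filter_upwards [eventually_gt_atTop 0] with t ht
  exact mul_div_mul_left _ _ (gpos t ht).ne'
end
end

section
/- Let X and Y be perfectly normal topological spaces; let X carry a continuous scaling T and the ideal S_X generated by a finite continuous modulus τ_X. Define a scaling on X × Y by T_t(x, y) = (T_t x, y), and let V be the ideal of all subsets of X × Y contained in some B × Y with B ∈ S_X. Let ξ be a Baire random element of X with ξ ∈ RV(X, T, S_X, g, μ), where the tail measure μ is τ-additive. Let (κ_x)_{x∈X} be a measurable family of Baire probability measures on Y (the laws of a Y-valued process (η_x)_{x∈X} independent of ξ) such that, for every bounded continuous h : Y → ℝ, ∫ h dκ_x → ∫ h dP_W along the filter of sets {x : τ_X(x) > u}, u → ∞, where P_W is a τ-additive Baire probability measure on Y. Let ν be the joint law of (ξ, η_ξ), i.e. ν(A) = ∫_X κ_x({y : (x, y) ∈ A}) P_ξ(dx). Then ν ∈ RV(X × Y, T, V, g,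 μ′), where μ′ ∈ M(V) is the measure extending the product μ ⊗ P_W, characterised by ∫ f(x)h(y) μ′(d(x,y)) = (∫ f dμ)·(∫ h dP_W) for every bounded continuous f : X → ℝ with support in S_X and every bounded continuous h : Y → ℝ. -/
open MeasureTheory Filter Topology Set
open scoped ENNReal NNReal

noncomputable section

lemma PerfectlyNormal.functionallyOpen {X : Type*} [TopologicalSpace X] (hX : PerfectlyNormal X)
    {U : Set X} (hU : IsOpen U) : FunctionallyOpen U := by
  obtain ⟨f, hf, hf01, h0, -⟩ := hX Uᶜ ∅ hU.isClosed_compl isClosed_empty (disjoint_empty _)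
  refine ⟨f, hf, fun x => (hf01 x).1, ?_⟩
  ext x
  have : x ∈ Uᶜ ↔ f x = 0 := by rw [h0]; rfl
  rw [mem_compl_iff] at this
  simp only [mem_ofPred_eq]
  rw [(hf01 x).1.lt_iff_ne', ne_eq, ← this, not_not]

lemma FunctionallyOpen.isOpen {X : Type*} [TopologicalSpace X] {U : Set X}
    (hU : FunctionallyOpen U) : IsOpen U := by
  obtain ⟨f, hf, -, rfl⟩ := hU
  exact isOpen_lt continuous_const hf

lemma Continuous.measurable_of_eq_baire {X : Type*} [TopologicalSpace X] [m : MeasurableSpace X]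
    (hm : m = baire X) {f : X → ℝ} (hf : Continuous f) : Measurable f := by
  rw [measurable_iff_comap_le, hm]
  exact le_iSup (fun g : {g : X → ℝ // Continuous g} => MeasurableSpace.comap g.1 (borel ℝ)) ⟨f, hf⟩

lemma FunctionallyOpen.measurableSet_of_eq_baire {X : Type*} [TopologicalSpace X]
    [m : MeasurableSpace X] (hm : m = baire X) {U : Set X} (hU : FunctionallyOpen U) :
    MeasurableSet U := by
  obtain ⟨f, hf, -, rfl⟩ := hU
  exact measurableSet_lt measurable_const (hf.measurable_of_eq_baire hm)

lemma PerfectlyNormal.opensMeasurableSpace {X : Type*} [TopologicalSpace X]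
    [m : MeasurableSpace X] (hX : PerfectlyNormal X) (hm : m = baire X) :
    OpensMeasurableSpace X :=
  ⟨MeasurableSpace.generateFrom_le fun _ hU =>
    (hX.functionallyOpen hU).measurableSet_of_eq_baire hm⟩

lemma baire_eq_generateFrom (X : Type*) [TopologicalSpace X] :
    baire X = MeasurableSpace.generateFrom {U : Set X | FunctionallyOpen U} := by
  apply le_antisymm
  · refine iSup_le fun f => ?_
    refine measurable_iff_comap_le.1 ?_
    let _ := MeasurableSpace.generateFrom {U : Set X | FunctionallyOpen U}
    refine measurable_of_Ioi fun a => ?_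
    refine MeasurableSpace.measurableSet_generateFrom
      ⟨fun x => max (f.1 x - a) 0, (f.2.sub continuous_const).max continuous_const,
        fun x => le_max_right _ _, ?_⟩
    ext x
    simp
  · refine MeasurableSpace.generateFrom_le fun U hU => ?_
    exact @FunctionallyOpen.measurableSet_of_eq_baire X _ (baire X) rfl U hU

lemma isPiSystem_functionallyOpen (X : Type*) [TopologicalSpace X] :
    IsPiSystem {U : Set X | FunctionallyOpen U} := by
  rintro _ ⟨f, hf, -, rfl⟩ _ ⟨g, hg, -, rfl⟩ -
  refine ⟨fun x => max (min (f x) (g x)) 0, (hf.min hg).max continuous_const,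
    fun x => le_max_right _ _, ?_⟩
  ext x
  simp

lemma Continuous.measurable_into_baire {X Z : Type*} [TopologicalSpace X] [MeasurableSpace X]
    [OpensMeasurableSpace X] [TopologicalSpace Z] [m : MeasurableSpace Z] (hm : m = baire Z)
    {i : X → Z} (hi : Continuous i) : Measurable i := by
  subst hm
  rw [baire_eq_generateFrom]
  exact measurable_generateFrom fun U hU => (hU.isOpen.preimage hi).measurableSet

/-- In a perfectly normal space, τ-additivity yields a member of a union-closed family of open sets
whose measure exceeds any value below the measure of the union. -/
lemma TauAdditive.exists_lt {X : Type*} [TopologicalSpace X] [MeasurableSpace X]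
    (hX : PerfectlyNormal X) {μ : Measure X} (hμ : TauAdditive μ) {𝒢 : Set (Set X)}
    (hne : 𝒢.Nonempty) (ho : ∀ G ∈ 𝒢, IsOpen G) (hu : ∀ A ∈ 𝒢, ∀ B ∈ 𝒢, A ∪ B ∈ 𝒢)
    {c : ℝ≥0∞} (hc : c < μ (⋃₀ 𝒢)) : ∃ G ∈ 𝒢, c < μ G := by
  rw [hμ 𝒢 hne (fun G hG => hX.functionallyOpen (ho G hG))
    (fun A hA B hB => ⟨A ∪ B, hu A hA B hB, subset_union_left, subset_union_right⟩)
    (hX.functionallyOpen (isOpen_sUnion ho))] at hc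
  simpa [lt_iSup_iff] using hc

lemma sum_step_le (a : ℝ) (ha : 0 ≤ a) (n : ℕ) :
    ∑ k ∈ Finset.range n, (if ((k : ℝ) + 1) < a then (1 : ℝ) else 0) ≤ min a n := by
  induction n with
  | zero => simp [ha]
  | succ n ih =>
    rw [Finset.sum_range_succ]
    push_cast
    obtain ⟨h1, h2⟩ := le_min_iff.1 ih
    split_ifs with h
    · exact le_min (by linarith) (by linarith)
    · exact le_min (by linarith) (by linarith)

lemma le_sum_step (a : ℝ) (n : ℕ) :
    min a (n + 1) - 1 ≤ ∑ k ∈ Finset.range n, (if ((k : ℝ) + 1) < a then (1 : ℝ) else 0) := by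
  induction n with
  | zero => simp
  | succ n ih =>
    rw [Finset.sum_range_succ]
    push_cast
    split_ifs with h
    · rw [min_eq_right h.le] at ih
      linarith [min_le_right a ((n : ℝ) + 1 + 1)]
    · rw [min_eq_left (not_lt.1 h)] at ih
      linarith [min_le_left a ((n : ℝ) + 1 + 1)]

/-- The equidistant step approximation from below of a function with values in `[0, 1]`. -/
def stepApprox {X : Type*} (p : X → ℝ) (n : ℕ) (x : X) : ℝ≥0∞ :=
  ENNReal.ofReal (1 / (n : ℝ)) *
    ∑ k ∈ Finset.range n, {x | ((k : ℝ) + 1) / n < p x}.indicator (fun _ => 1) x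

lemma stepApprox_eq {X : Type*} (p : X → ℝ) {n : ℕ} (hn : 0 < n) (x : X) :
    stepApprox p n x = ENNReal.ofReal (1 / (n : ℝ) *
      ∑ k ∈ Finset.range n, (if ((k : ℝ) + 1) < n * p x then (1 : ℝ) else 0)) := by
  rw [stepApprox, ENNReal.ofReal_mul (by positivity),
    ENNReal.ofReal_sum_of_nonneg (fun k _ => by split_ifs <;> norm_num)]
  congr 1
  refine Finset.sum_congr rfl fun k _ => ?_
  have : ((k : ℝ) + 1) / n < p x ↔ (k : ℝ) + 1 < n * p x := by
    rw [div_lt_iff₀ (by positivity), mul_comm]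
  by_cases h : (k : ℝ) + 1 < n * p x
  · rw [indicator_of_mem (by exact this.2 h), if_pos h, ENNReal.ofReal_one]
  · rw [indicator_of_notMem (show x ∉ {x | ((k : ℝ) + 1) / n < p x} from fun h' => h (this.1 h')),
      if_neg h, ENNReal.ofReal_zero]

lemma stepApprox_le {X : Type*} {p : X → ℝ} (hp : ∀ x, 0 ≤ p x) {n : ℕ} (hn : 0 < n) (x : X) :
    stepApprox p n x ≤ ENNReal.ofReal (p x) := by
  rw [stepApprox_eq p hn]
  apply ENNReal.ofReal_le_ofReal
  have hn' : (0 : ℝ) < n := by exact_mod_cast hn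
  rw [one_div, inv_mul_le_iff₀ hn']
  exact (sum_step_le _ (mul_nonneg hn'.le (hp x)) n).trans (min_le_left _ _)

lemma tendsto_stepApprox {X : Type*} {p : X → ℝ} (hp : ∀ x, 0 ≤ p x) (hp1 : ∀ x, p x ≤ 1) (x : X) :
    Tendsto (fun n => stepApprox p n x) atTop (𝓝 (ENNReal.ofReal (p x))) := by
  have h1 : Tendsto (fun n : ℕ => ENNReal.ofReal (p x - 1 / (n : ℝ))) atTop
      (𝓝 (ENNReal.ofReal (p x))) := by
    apply ENNReal.tendsto_ofReal
    simpa using tendsto_const_nhds (x := p x).sub (tendsto_one_div_atTop_nhds_zero_nat (𝕜 := ℝ))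
  refine tendsto_of_tendsto_of_tendsto_of_le_of_le' h1 tendsto_const_nhds ?_ ?_
  · filter_upwards [eventually_gt_atTop 0] with n hn
    rw [stepApprox_eq p hn]
    apply ENNReal.ofReal_le_ofReal
    have hn' : (0 : ℝ) < n := by exact_mod_cast hn
    have h := le_sum_step (n * p x) n
    rw [min_eq_left (by nlinarith [hp1 x])] at h
    rw [one_div, le_inv_mul_iff₀ hn', mul_sub, mul_inv_cancel₀ hn'.ne']
    exact h
  · filter_upwards [eventually_gt_atTop 0] with n hn using stepApprox_le hp hn x

lemma lintegral_stepApprox {X : Type*} [MeasurableSpace X] (μ : Measure X) {p : X → ℝ}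
    (hp : ∀ c, MeasurableSet {x | c < p x}) (n : ℕ) :
    ∫⁻ x, stepApprox p n x ∂μ =
      ENNReal.ofReal (1 / (n : ℝ)) * ∑ k ∈ Finset.range n, μ {x | ((k : ℝ) + 1) / n < p x} := by
  unfold stepApprox
  rw [lintegral_const_mul _ (Finset.measurable_fun_sum _ fun k _ =>
      measurable_const.indicator (hp _)),
    lintegral_finsetSum _ (fun k _ => measurable_const.indicator (hp _))]
  simp only [lintegral_indicator_const (hp _), one_mul]

/-- Monotone convergence along directed families of lower semicontinuous functions, for
τ-additive measures. -/
lemma TauAdditive.lintegral_le_iSup {X ι : Type*} [TopologicalSpace X] [MeasurableSpace X]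
    [OpensMeasurableSpace X] [Nonempty ι]
    (hX : PerfectlyNormal X) {μ : Measure X} (hμ : TauAdditive μ) {p : X → ℝ} {q : ι → X → ℝ}
    (hp : ∀ x, 0 ≤ p x) (hp1 : ∀ x, p x ≤ 1) (hq : ∀ i x, 0 ≤ q i x)
    (hdir : ∀ i j, ∃ k, ∀ x, q i x ≤ q k x ∧ q j x ≤ q k x)
    (hpo : ∀ c, IsOpen {x | c < p x}) (hqo : ∀ i c, IsOpen {x | c < q i x})
    (hsup : ∀ c x, c < p x → ∃ i, c < q i x) :
    ∫⁻ x, ENNReal.ofReal (p x) ∂μ ≤ ⨆ i, ∫⁻ x, ENNReal.ofReal (q i x) ∂μ := by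
  have hle (c : ℝ) : μ {x | c < p x} ≤ ⨆ i, μ {x | c < q i x} := by
    have hU : IsOpen (⋃₀ range fun i => {x | c < q i x}) :=
      isOpen_sUnion (by rintro _ ⟨i, rfl⟩; exact hqo i c)
    calc μ {x | c < p x} ≤ μ (⋃₀ range fun i => {x | c < q i x}) := by
          refine measure_mono fun x hx => ?_
          obtain ⟨i, hi⟩ := hsup c x hx
          exact ⟨_, ⟨i, rfl⟩, hi⟩
      _ = ⨆ i, μ {x | c < q i x} := by
          rw [hμ _ (range_nonempty _) (by rintro _ ⟨i, rfl⟩; exact hX.functionallyOpen (hqo i c)) ?_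
            (hX.functionallyOpen hU), iSup_range]
          rintro _ ⟨i, rfl⟩ _ ⟨j, rfl⟩
          obtain ⟨k, hk⟩ := hdir i j
          exact ⟨_, ⟨k, rfl⟩, fun x (hx : c < q i x) => hx.trans_le (hk x).1,
            fun x (hx : c < q j x) => hx.trans_le (hk x).2⟩
  have hstep (n : ℕ) (hn : 0 < n) :
      ∫⁻ x, stepApprox p n x ∂μ ≤ ⨆ i, ∫⁻ x, ENNReal.ofReal (q i x) ∂μ := by
    rw [lintegral_stepApprox μ (fun c => (hpo c).measurableSet)]
    calc _ ≤ ENNReal.ofReal (1 / (n : ℝ)) *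
            ∑ k ∈ Finset.range n, ⨆ i, μ {x | ((k : ℝ) + 1) / n < q i x} := by
          gcongr with k
          exact hle _
      _ = ⨆ i, ∫⁻ x, stepApprox (q i) n x ∂μ := by
          rw [ENNReal.finsetSum_iSup, ENNReal.mul_iSup]
          · simp_rw [lintegral_stepApprox μ (fun c => (hqo _ c).measurableSet)]
          · intro i j
            obtain ⟨k, hk⟩ := hdir i j
            exact ⟨k, fun a => ⟨measure_mono fun x hx => lt_of_lt_of_le hx (hk x).1,
              measure_mono fun x hx => lt_of_lt_of_le hx (hk x).2⟩⟩
      _ ≤ _ := iSup_mono fun i => lintegral_mono (stepApprox_le (hq i) hn)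
  calc ∫⁻ x, ENNReal.ofReal (p x) ∂μ
      = ∫⁻ x, liminf (fun n => stepApprox p n x) atTop ∂μ := by
        simp_rw [(tendsto_stepApprox hp hp1 _).liminf_eq]
    _ ≤ liminf (fun n => ∫⁻ x, stepApprox p n x ∂μ) atTop := by
        refine lintegral_liminf_le fun n => ?_
        exact measurable_const.mul (Finset.measurable_fun_sum _ fun k _ =>
          measurable_const.indicator (hpo _).measurableSet)
    _ ≤ _ := by
        refine liminf_le_of_frequently_le' (Eventually.frequently ?_)
        filter_upwards [eventually_gt_atTop 0] with n hn using hstep n hn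

lemma TauAdditive.exists_measureReal_diff_lt {X : Type*} [TopologicalSpace X] [MeasurableSpace X]
    [OpensMeasurableSpace X] (hX : PerfectlyNormal X) {μ : Measure X} (hμ : TauAdditive μ)
    {𝒢 : Set (Set X)} (hempty : ∅ ∈ 𝒢) (ho : ∀ G ∈ 𝒢, IsOpen G)
    (hu : ∀ A ∈ 𝒢, ∀ B ∈ 𝒢, A ∪ B ∈ 𝒢) {W : Set X} (hW : ⋃₀ 𝒢 = W) (hfin : μ W ≠ ∞)
    {δ : ℝ} (hδ : 0 < δ) : ∃ G ∈ 𝒢, μ.real (W \ G) < δ := by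
  subst hW
  rcases eq_or_ne (μ (⋃₀ 𝒢)) 0 with h0 | h0
  · exact ⟨∅, hempty, by simpa [measureReal_def, h0] using hδ⟩
  have hpos : 0 < μ.real (⋃₀ 𝒢) := ENNReal.toReal_pos h0 hfin
  have hc : ENNReal.ofReal (μ.real (⋃₀ 𝒢) - δ) < μ (⋃₀ 𝒢) := by
    rw [← ENNReal.ofReal_toReal hfin]
    exact (ENNReal.ofReal_lt_ofReal_iff hpos).2 (sub_lt_self _ hδ)
  obtain ⟨G, hG, hlt⟩ := hμ.exists_lt hX ⟨∅, hempty⟩ ho hu hc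
  have hGW : G ⊆ ⋃₀ 𝒢 := subset_sUnion_of_mem hG
  have hGfin : μ G ≠ ∞ := measure_ne_top_of_subset hGW hfin
  refine ⟨G, hG, ?_⟩
  rw [measureReal_sdiff hGW (ho G hG).measurableSet hfin]
  have : μ.real (⋃₀ 𝒢) - δ < μ.real G := by
    by_contra! h
    exact hlt.not_ge (by rw [← ENNReal.ofReal_toReal hGfin]; exact ENNReal.ofReal_le_ofReal h)
  linarith

/-- Sections of an open set depend lower semicontinuously on the point, in τ-additive measure. -/
lemma TauAdditive.isOpen_lt_section {X Y : Type*} [TopologicalSpace X] [TopologicalSpace Y]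
    [MeasurableSpace Y] (hY : PerfectlyNormal Y) {P : Measure Y} (hP : TauAdditive P)
    {G : Set (X × Y)} (hG : IsOpen G) (c : ℝ≥0∞) : IsOpen {x | c < P (Prod.mk x ⁻¹' G)} := by
  rw [isOpen_iff_mem_nhds]
  intro x₀ hx₀
  let 𝒢 : Set (Set Y) := {V | IsOpen V ∧ ∃ U ∈ 𝓝 x₀, U ×ˢ V ⊆ G}
  have hsU : ⋃₀ 𝒢 = Prod.mk x₀ ⁻¹' G := by
    apply Subset.antisymm
    · rintro y ⟨V, ⟨-, U, hU, hUV⟩, hy⟩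
      exact hUV ⟨mem_of_mem_nhds hU, hy⟩
    · intro y hy
      obtain ⟨U, V, hU, hxU, hV, hyV, hUV⟩ :=
        mem_nhds_prod_iff'.1 (hG.mem_nhds (show (x₀, y) ∈ G from hy))
      exact ⟨V, ⟨hV, U, hU.mem_nhds hxU, hUV⟩, hyV⟩
  obtain ⟨V, ⟨-, U, hU, hUV⟩, hc⟩ := hP.exists_lt hY (𝒢 := 𝒢)
    ⟨∅, isOpen_empty, univ, univ_mem, by simp⟩ (fun V hV => hV.1)
    (by
      rintro V ⟨hV, U, hU, hUV⟩ V' ⟨hV', U', hU', hUV'⟩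
      refine ⟨hV.union hV', U ∩ U', inter_mem hU hU', ?_⟩
      rintro ⟨x, y⟩ ⟨⟨hx, hx'⟩, hy | hy⟩
      exacts [hUV ⟨hx, hy⟩, hUV' ⟨hx', hy⟩]) (by rw [hsU]; exact hx₀)
  filter_upwards [hU] with x hx
  exact hc.trans_le (measure_mono fun y hy => hUV ⟨hx, hy⟩)

lemma aemeasurable_of_lintegral_add_compl_eq {X : Type*} [MeasurableSpace X] {m : Measure X}
    [IsProbabilityMeasure m] {u v : X → ℝ≥0∞} (huv : ∀ x, u x + v x = 1)
    (h : ∫⁻ x, u x ∂m + ∫⁻ x, v x ∂m = 1) : AEMeasurable u m := by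
  obtain ⟨u', hu', hle, hu⟩ := exists_measurable_le_lintegral_eq m u
  obtain ⟨v', hv', hle', hv⟩ := exists_measurable_le_lintegral_eq m v
  have hsum : u' + v' =ᵐ[m] 1 := by
    refine ae_eq_of_ae_le_of_lintegral_le ?_ ?_ aemeasurable_const ?_
    · exact .of_forall fun x => (add_le_add (hle x) (hle' x)).trans_eq (huv x)
    · simp only [Pi.add_apply]
      rw [lintegral_add_left hu', ← hu, ← hv, h]
      exact ENNReal.one_ne_top
    · simp only [Pi.add_apply, Pi.one_apply]
      rw [lintegral_add_left hu', ← hu, ← hv, h]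
      simp
  refine ⟨u', hu', ?_⟩
  filter_upwards [hsum] with x hx
  refine le_antisymm ?_ (hle x)
  have hvtop : v x ≠ ∞ := by
    intro h'
    simpa [h'] using huv x
  have : u x + v x ≤ u' x + v x := by
    rw [huv x, ← Pi.one_apply (M := fun _ => ℝ≥0∞) x, ← hx]
    exact add_le_add le_rfl (hle' x)
  exact (ENNReal.add_le_add_iff_right hvtop).1 this

section Mixture

variable {X Y Z : Type*} [MeasurableSpace X] [MeasurableSpace Y] [MeasurableSpace Z]
  {m : Measure X} {K : X → Measure Y} {i : X → Y → Z} {ν : Measure Z}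

lemma lintegral_mixture (hi : ∀ x, Measurable (i x))
    (hae : ∀ A, MeasurableSet A → AEMeasurable (fun x => K x (i x ⁻¹' A)) m)
    (hν : ∀ A, MeasurableSet A → ν A = ∫⁻ x, K x (i x ⁻¹' A) ∂m)
    {F : Z → ℝ≥0∞} (hF : Measurable F) :
    AEMeasurable (fun x => ∫⁻ y, F (i x y) ∂K x) m ∧
      ∫⁻ z, F z ∂ν = ∫⁻ x, ∫⁻ y, F (i x y) ∂K x ∂m := by
  refine Measurable.ennreal_induction
    (motive := fun F => AEMeasurable (fun x => ∫⁻ y, F (i x y) ∂K x) m ∧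
      ∫⁻ z, F z ∂ν = ∫⁻ x, ∫⁻ y, F (i x y) ∂K x ∂m)
    (fun c s hs => ?_) (fun f g _ hf hg ihf ihg => ?_) (fun f hf hmono ih => ?_) hF
  · have key (x : X) : ∫⁻ y, s.indicator (fun _ => c) (i x y) ∂K x = c * K x (i x ⁻¹' s) := by
      rw [← lintegral_indicator_const (hi x hs)]
      rfl
    simp_rw [key, lintegral_indicator_const hs, hν s hs]
    exact ⟨(hae s hs).const_mul c, (lintegral_const_mul'' _ (hae s hs)).symm⟩
  · have key (x : X) : ∫⁻ y, (f + g) (i x y) ∂K x =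
        ∫⁻ y, f (i x y) ∂K x + ∫⁻ y, g (i x y) ∂K x :=
      lintegral_add_left (hf.comp (hi x)) _
    simp_rw [key]
    refine ⟨ihf.1.add ihg.1, ?_⟩
    rw [lintegral_add_left' ihf.1, ← ihf.2, ← ihg.2]
    exact lintegral_add_left hf _
  · have key (x : X) : ∫⁻ y, ⨆ n, f n (i x y) ∂K x = ⨆ n, ∫⁻ y, f n (i x y) ∂K x :=
      lintegral_iSup (fun n => (hf n).comp (hi x)) fun a b hab y => hmono hab _
    simp_rw [key]
    refine ⟨.iSup fun n => (ih n).1, ?_⟩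
    rw [lintegral_iSup hf hmono, lintegral_iSup' (fun n => (ih n).1)
      (.of_forall fun x a b hab => lintegral_mono fun y => hmono hab _)]
    simp_rw [(ih _).2]

lemma integral_mixture [∀ x, IsProbabilityMeasure (K x)] (hi : ∀ x, Measurable (i x))
    (hae : ∀ A, MeasurableSet A → AEMeasurable (fun x => K x (i x ⁻¹' A)) m)
    (hν : ∀ A, MeasurableSet A → ν A = ∫⁻ x, K x (i x ⁻¹' A) ∂m)
    {F : Z → ℝ} (hF : Measurable F) {C : ℝ} (hC : ∀ z, |F z| ≤ C) (hint : Integrable F ν) :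
    Integrable (fun x => ∫ y, F (i x y) ∂K x) m ∧
      ∫ z, F z ∂ν = ∫ x, ∫ y, F (i x y) ∂K x ∂m := by
  obtain ⟨ha, ha'⟩ := lintegral_mixture hi hae hν hF.ennreal_ofReal
  obtain ⟨hb, hb'⟩ := lintegral_mixture hi hae hν hF.neg.ennreal_ofReal
  have hin (x : X) : Integrable (fun y => F (i x y)) (K x) :=
    .of_bound (hF.comp (hi x)).aestronglyMeasurable C (.of_forall fun y => hC _)
  have hafin : ∫⁻ z, ENNReal.ofReal (F z) ∂ν ≠ ∞ := hint.lintegral_lt_top.ne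
  have hbfin : ∫⁻ z, ENNReal.ofReal (-F z) ∂ν ≠ ∞ := hint.neg.lintegral_lt_top.ne
  simp only [Pi.neg_apply] at hb hb'
  rw [ha'] at hafin
  rw [hb'] at hbfin
  have key (x : X) : ∫ y, F (i x y) ∂K x = (∫⁻ y, ENNReal.ofReal (F (i x y)) ∂K x).toReal -
      (∫⁻ y, ENNReal.ofReal (-F (i x y)) ∂K x).toReal :=
    integral_eq_lintegral_pos_part_sub_lintegral_neg_part (hin x)
  simp_rw [key]
  have hia := integrable_toReal_of_lintegral_ne_top ha hafin
  have hib := integrable_toReal_of_lintegral_ne_top hb hbfin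
  refine ⟨hia.sub hib, ?_⟩
  rw [integral_sub hia hib,
    integral_toReal ha (.of_forall fun x => (hin x).lintegral_lt_top),
    integral_toReal hb (.of_forall fun x => (hin x).neg.lintegral_lt_top),
    ← ha', ← hb', integral_eq_lintegral_pos_part_sub_lintegral_neg_part hint]

end Mixture

lemma integrable_of_bounded_of_support_subset {X : Type*} [MeasurableSpace X] {μ : Measure X}
    {F : X → ℝ} (hF : Measurable F) {C : ℝ} (hC : ∀ x, |F x| ≤ C) {A : Set X}
    (hA : Function.support F ⊆ A) (hμA : μ A ≠ ∞) : Integrable F μ := by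
  have hs : μ (Function.support F) ≠ ∞ := measure_ne_top_of_subset hA hμA
  rw [← integrableOn_iff_integrable_of_support_subset (Subset.refl (Function.support F))]
  exact Measure.integrableOn_of_bounded (M := C) hs hF.aestronglyMeasurable
    (.of_forall fun x => hC x)

lemma tendsto_integral_mul_cutoff {X : Type*} [MeasurableSpace X] {μ : Measure X}
    {φ χ : X → ℝ} (hφ : Measurable φ) (hφ0 : ∀ x, 0 ≤ φ x) (hχ : Integrable χ μ) :
    Tendsto (fun n : ℕ => ∫ x, χ x * max 0 (1 - n * φ x) ∂μ) atTop
      (𝓝 (∫ x, {x | φ x = 0}.indicator χ x ∂μ)) := by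
  refine tendsto_integral_of_dominated_convergence (fun x => |χ x|) (fun n => ?_) hχ.abs
    (fun n => .of_forall fun x => ?_) (.of_forall fun x => ?_)
  · exact hχ.aestronglyMeasurable.mul (by fun_prop)
  · have h1 : max 0 (1 - n * φ x) ≤ 1 :=
      max_le zero_le_one (by linarith [mul_nonneg (Nat.cast_nonneg (α := ℝ) n) (hφ0 x)])
    rw [Real.norm_eq_abs, abs_mul, abs_of_nonneg (le_max_left 0 (1 - n * φ x))]
    exact mul_le_of_le_one_right (abs_nonneg _) h1
  · by_cases h : φ x = 0
    · simp [h]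
    · have hpos : 0 < φ x := (hφ0 x).lt_of_ne' h
      rw [indicator_of_notMem (show x ∉ {x | φ x = 0} from h)]
      refine tendsto_const_nhds.congr' ?_
      filter_upwards [eventually_ge_atTop ⌈1 / φ x⌉₊] with n hn
      have : 1 ≤ n * φ x := (div_le_iff₀ hpos).1 ((Nat.le_ceil _).trans (by exact_mod_cast hn))
      rw [max_eq_left (by linarith), mul_zero]

/-- A bounded continuous function on a product is locally uniformly continuous in the first
variable, up to a continuous error of small integral. -/
lemma TauAdditive.exists_local_error {X Y : Type*} [TopologicalSpace X] [TopologicalSpace Y]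
    [MeasurableSpace Y] [OpensMeasurableSpace Y] (hY : PerfectlyNormal Y) {P : Measure Y}
    [IsProbabilityMeasure P] (hP : TauAdditive P) {F : X × Y → ℝ} (hF : Continuous F) {C : ℝ}
    (hC : ∀ p, |F p| ≤ C) (x₀ : X) {δ : ℝ} (hδ : 0 < δ) :
    ∃ U ∈ 𝓝 x₀, ∃ b : Y → ℝ, Continuous b ∧ (∀ y, 0 ≤ b y) ∧ (∀ y, b y ≤ 1) ∧
      ∫ y, b y ∂P < δ ∧ ∀ x ∈ U, ∀ y, |F (x, y) - F (x₀, y)| ≤ δ + 2 * C * b y := by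
  let 𝒢 : Set (Set Y) := {V | IsOpen V ∧ ∃ U ∈ 𝓝 x₀, ∀ x ∈ U, ∀ y ∈ V,
    |F (x, y) - F (x₀, y)| < δ}
  have hsU : ⋃₀ 𝒢 = univ := by
    refine eq_univ_of_forall fun y => ?_
    have hcont : Continuous fun p : X × Y => |F p - F (x₀, p.2)| := by fun_prop
    have hopen : IsOpen {p : X × Y | |F p - F (x₀, p.2)| < δ} :=
      isOpen_lt hcont continuous_const
    obtain ⟨U, V, hU, hxU, hV, hyV, hUV⟩ := mem_nhds_prod_iff'.1
      (hopen.mem_nhds (show (x₀, y) ∈ _ by simpa using hδ))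
    exact ⟨V, ⟨hV, U, hU.mem_nhds hxU, fun x hx y hy => hUV (mk_mem_prod hx hy)⟩, hyV⟩
  obtain ⟨V, ⟨hV, U, hU, hUV⟩, hlt⟩ := hP.exists_measureReal_diff_lt hY (𝒢 := 𝒢)
    ⟨isOpen_empty, univ, univ_mem, by simp⟩ (fun V hV => hV.1)
    (by
      rintro V ⟨hV, U, hU, hUV⟩ V' ⟨hV', U', hU', hUV'⟩
      refine ⟨hV.union hV', U ∩ U', inter_mem hU hU', ?_⟩
      rintro x ⟨hx, hx'⟩ y (hy | hy)
      exacts [hUV x hx y hy, hUV' x hx' y hy]) hsU (measure_ne_top _ _) hδ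
  obtain ⟨φ, hφ, hφ0, rfl⟩ := hY.functionallyOpen hV
  have hlim := tendsto_integral_mul_cutoff hφ.measurable hφ0 (integrable_const (μ := P) (1 : ℝ))
  have heq : ∫ y, {y | φ y = 0}.indicator (fun _ => (1 : ℝ)) y ∂P =
      P.real (univ \ {y | 0 < φ y}) := by
    have : univ \ {y | 0 < φ y} = {y | φ y = 0} := by
      ext y
      simpa using ⟨fun h => le_antisymm h (hφ0 y), fun h => h.le⟩
    have hm : MeasurableSet {y | φ y = 0} := hφ.measurable (measurableSet_singleton 0)
    rw [this, integral_indicator_const _ hm, smul_eq_mul, mul_one]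
  rw [heq] at hlim
  obtain ⟨n, hn⟩ := (hlim.eventually_lt_const hlt).exists
  refine ⟨U, hU, fun y => max 0 (1 - n * φ y), by fun_prop, fun y => le_max_left _ _,
    fun y => max_le zero_le_one
      (by linarith [mul_nonneg (Nat.cast_nonneg (α := ℝ) n) (hφ0 y)]),
    by simpa using hn, fun x hx y => ?_⟩
  have hC0 : 0 ≤ C := (abs_nonneg _).trans (hC (x, y))
  rcases (hφ0 y).eq_or_lt with h | h
  · simp only [← h, mul_zero, sub_zero, zero_le_one, sup_of_le_right, mul_one]
    linarith [abs_sub (F (x, y)) (F (x₀, y)), hC (x, y), hC (x₀, y)]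
  · have := (hUV x hx y h).le
    have := mul_nonneg (mul_nonneg zero_le_two hC0) (le_max_left 0 (1 - n * φ y))
    linarith

lemma abs_integral_le_of_forall_abs_le {Y : Type*} [MeasurableSpace Y] (P : Measure Y)
    [IsProbabilityMeasure P] {u : Y → ℝ} {C : ℝ} (hu : ∀ y, |u y| ≤ C) : |∫ y, u y ∂P| ≤ C := by
  simpa using norm_integral_le_of_norm_le_const (μ := P) (f := u) (.of_forall hu)

lemma abs_integral_sub_integral_le {Y : Type*} [TopologicalSpace Y] [MeasurableSpace Y]
    [OpensMeasurableSpace Y] (P : Measure Y) [IsProbabilityMeasure P] {u v b : Y → ℝ}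
    (hu : Continuous u) (hv : Continuous v) (hb : Continuous b) {C D δ : ℝ}
    (huC : ∀ y, |u y| ≤ C) (hvC : ∀ y, |v y| ≤ C) (hb0 : ∀ y, 0 ≤ b y) (hb1 : ∀ y, b y ≤ 1)
    (h : ∀ y, |u y - v y| ≤ δ + D * b y) :
    |∫ y, u y ∂P - ∫ y, v y ∂P| ≤ δ + D * ∫ y, b y ∂P := by
  have hui : Integrable u P := .of_bound hu.measurable.aestronglyMeasurable C (.of_forall huC)
  have hvi : Integrable v P := .of_bound hv.measurable.aestronglyMeasurable C (.of_forall hvC)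
  have hbi : Integrable b P := .of_bound hb.measurable.aestronglyMeasurable 1
    (.of_forall fun y => by rw [Real.norm_eq_abs, abs_of_nonneg (hb0 y)]; exact hb1 y)
  rw [← integral_sub hui hvi]
  calc _ ≤ ∫ y, |u y - v y| ∂P := abs_integral_le_integral_abs
    _ ≤ ∫ y, (δ + D * b y) ∂P :=
        integral_mono (hui.sub hvi).abs ((integrable_const _).add (hbi.const_mul _)) h
    _ = _ := by
        rw [integral_add (integrable_const _) (hbi.const_mul _), integral_const_mul]
        simp

lemma TauAdditive.continuous_integral {X Y : Type*} [TopologicalSpace X] [TopologicalSpace Y]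
    [MeasurableSpace Y] [OpensMeasurableSpace Y] (hY : PerfectlyNormal Y) {P : Measure Y}
    [IsProbabilityMeasure P] (hP : TauAdditive P) {F : X × Y → ℝ} (hF : Continuous F) {C : ℝ}
    (hC : ∀ p, |F p| ≤ C) : Continuous fun x => ∫ y, F (x, y) ∂P := by
  rw [continuous_iff_continuousAt]
  intro x₀
  obtain ⟨y₀⟩ := P.nonempty_of_neZero
  have hC0 : 0 ≤ C := (abs_nonneg _).trans (hC (x₀, y₀))
  rw [ContinuousAt, Metric.tendsto_nhds]
  intro η hη
  obtain ⟨U, hU, b, hb, hb0, hb1, hbP, hUb⟩ :=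
    hP.exists_local_error hY hF hC x₀ (δ := η / 2 / (1 + 2 * C)) (by positivity)
  filter_upwards [hU] with x hx
  rw [Real.dist_eq]
  calc _ ≤ η / 2 / (1 + 2 * C) + 2 * C * ∫ y, b y ∂P :=
        abs_integral_sub_integral_le P (by fun_prop) (by fun_prop) hb (fun y => hC _)
          (fun y => hC _) hb0 hb1 (hUb x hx)
    _ ≤ η / 2 / (1 + 2 * C) + 2 * C * (η / 2 / (1 + 2 * C)) := by gcongr
    _ = η / 2 := by field_simp
    _ < η := half_lt_self hη

lemma TauAdditive.exists_uniform {X Y : Type*} [TopologicalSpace X] [TopologicalSpace Y]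
    [MeasurableSpace Y] [OpensMeasurableSpace Y] (hY : PerfectlyNormal Y) {P : Measure Y}
    [IsProbabilityMeasure P] (hP : TauAdditive P) {τ : X → ℝ} {κ : X → Measure Y}
    [∀ x, IsProbabilityMeasure (κ x)]
    (hweak : ∀ h : Y → ℝ, Continuous h → (∃ C : ℝ, ∀ y, |h y| ≤ C) →
      Tendsto (fun x : X => ∫ y, h y ∂(κ x)) (Filter.comap τ atTop) (𝓝 (∫ y, h y ∂P)))
    {F : X × Y → ℝ} (hF : Continuous F) {C : ℝ} (hC : ∀ p, |F p| ≤ C) (x₀ : X) {δ : ℝ}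
    (hδ : 0 < δ) :
    ∃ U ∈ 𝓝 x₀, ∃ R : ℝ, ∀ x' ∈ U, ∀ x, R ≤ τ x →
      |∫ y, F (x', y) ∂κ x - ∫ y, F (x', y) ∂P| ≤ δ := by
  obtain ⟨y₀⟩ := P.nonempty_of_neZero
  have hC0 : 0 ≤ C := (abs_nonneg _).trans (hC (x₀, y₀))
  set η := δ / (3 * (1 + 2 * C)) with hη
  have hη0 : 0 < η := by positivity
  obtain ⟨U, hU, b, hb, hb0, hb1, hbP, hUb⟩ := hP.exists_local_error hY hF hC x₀ hη0
  have h1 := (hweak b hb ⟨1, fun y => by rw [abs_of_nonneg (hb0 y)]; exact hb1 y⟩)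
    |>.eventually_lt_const (hbP.trans (lt_two_mul_self hη0))
  have h2 := Metric.tendsto_nhds.1
    (hweak (fun y => F (x₀, y)) (by fun_prop) ⟨C, fun y => hC _⟩) η hη0
  obtain ⟨R, hR⟩ := eventually_atTop.1 (eventually_comap.1 (h1.and h2))
  refine ⟨U, hU, R, fun x' hx' x hx => ?_⟩
  obtain ⟨hbx, hFx⟩ := hR _ hx x rfl
  have e1 := abs_integral_sub_integral_le (κ x) (by fun_prop) (by fun_prop) hb
    (fun y => hC (x', y)) (fun y => hC (x₀, y)) hb0 hb1 (hUb x' hx')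
  have e2 := abs_integral_sub_integral_le P (by fun_prop) (by fun_prop) hb
    (fun y => hC (x', y)) (fun y => hC (x₀, y)) hb0 hb1 (hUb x' hx')
  rw [Real.dist_eq] at hFx
  have e3 : 2 * C * ∫ y, b y ∂κ x ≤ 2 * C * (2 * η) := by gcongr
  have e4 : 2 * C * ∫ y, b y ∂P ≤ 2 * C * η := by gcongr
  have e5 : 3 * (1 + 2 * C) * η = δ := by rw [hη]; field_simp
  rw [abs_le] at e1 e2 ⊢
  rw [abs_lt] at hFx
  constructor <;> linarith [e1.1, e1.2, e2.1, e2.2, hFx.1, hFx.2]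

/-- The τ-additive product of a τ-additive measure and a τ-additive probability measure, on the
Baire σ-algebra of the product space. -/
lemma TauAdditive.exists_prod {X Y : Type*} [TopologicalSpace X] [TopologicalSpace Y]
    [MeasurableSpace X] [MeasurableSpace Y] [mXY : MeasurableSpace (X × Y)]
    [OpensMeasurableSpace X] [OpensMeasurableSpace Y] (hmXY : mXY = baire (X × Y))
    (hX : PerfectlyNormal X) (hY : PerfectlyNormal Y) {μ : Measure X} (hμ : TauAdditive μ)
    {P : Measure Y} [IsProbabilityMeasure P] (hP : TauAdditive P) :
    ∃ μ' : Measure (X × Y), TauAdditive μ' ∧ ∀ A, MeasurableSet A →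
      AEMeasurable (fun x => P (Prod.mk x ⁻¹' A)) μ ∧
        μ' A = ∫⁻ x, P (Prod.mk x ⁻¹' A) ∂μ := by
  have hmk (x : X) : Measurable (Prod.mk x : Y → X × Y) :=
    (Continuous.prodMk_right x).measurable_into_baire hmXY
  let Q (x : X) : Measure (X × Y) := P.map (Prod.mk x)
  have hQprob (x : X) : IsProbabilityMeasure (Q x) :=
    Measure.isProbabilityMeasure_map (hmk x).aemeasurable
  have hQ : Measurable Q := by
    refine Measurable.measure_of_isPiSystem_of_isProbabilityMeasure
      (hmXY.trans (baire_eq_generateFrom _)) (isPiSystem_functionallyOpen _) fun G hG => ?_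
    have hGm := hG.measurableSet_of_eq_baire hmXY
    simp_rw [Q, Measure.map_apply (hmk _) hGm]
    exact measurable_of_Ioi fun c => (hP.isOpen_lt_section hY hG.isOpen c).measurableSet
  have hμ' (A : Set (X × Y)) (hA : MeasurableSet A) :
      μ.bind Q A = ∫⁻ x, P (Prod.mk x ⁻¹' A) ∂μ := by
    rw [Measure.bind_apply hA hQ.aemeasurable]
    simp_rw [Q, Measure.map_apply (hmk _) hA]
  refine ⟨μ.bind Q, ?_, fun A hA => ⟨?_, hμ' A hA⟩⟩
  · intro 𝒢 hne hfo hdir hU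
    apply le_antisymm _ (iSup₂_le fun G hG => measure_mono (subset_sUnion_of_mem hG))
    have : Nonempty 𝒢 := hne.to_subtype
    have hreal (G : Set (X × Y)) (hG : FunctionallyOpen G) :
        μ.bind Q G = ∫⁻ x, ENNReal.ofReal (P.real (Prod.mk x ⁻¹' G)) ∂μ := by
      rw [hμ' G (hG.measurableSet_of_eq_baire hmXY)]
      exact lintegral_congr fun x => (ofReal_measureReal (measure_ne_top _ _)).symm
    have hopen (G : Set (X × Y)) (hG : FunctionallyOpen G) (c : ℝ) :
        IsOpen {x | c < P.real (Prod.mk x ⁻¹' G)} := by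
      rcases lt_or_ge c 0 with hc | hc
      · rw [eq_univ_of_forall (s := {x | c < P.real (Prod.mk x ⁻¹' G)})
          fun x => hc.trans_le measureReal_nonneg]
        exact isOpen_univ
      · convert hP.isOpen_lt_section hY hG.isOpen (ENNReal.ofReal c) using 3 with x
        rw [ENNReal.ofReal_lt_iff_lt_toReal hc (measure_ne_top _ _)]
        rfl
    rw [hreal _ hU, iSup_subtype']
    have hle := hμ.lintegral_le_iSup hX (ι := 𝒢) (p := fun x => P.real (Prod.mk x ⁻¹' ⋃₀ 𝒢))
      (q := fun G x => P.real (Prod.mk x ⁻¹' G.1)) (fun x => measureReal_nonneg)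
      (fun x => measureReal_le_one) (fun i x => measureReal_nonneg)
      (fun G G' => by
        obtain ⟨H, hH, h, h'⟩ := hdir G G.2 G' G'.2
        exact ⟨⟨H, hH⟩, fun x => ⟨measureReal_mono (preimage_mono h),
          measureReal_mono (preimage_mono h')⟩⟩)
      (hopen _ hU) (fun G => hopen _ (hfo _ G.2)) (fun c x hc => by
        have hmono : Monotone fun S : Set (X × Y) => Prod.mk x ⁻¹' S := fun _ _ h =>
          preimage_mono h
        rcases lt_or_ge c 0 with hc0 | hc0
        · exact ⟨Classical.arbitrary _, hc0.trans_le measureReal_nonneg⟩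
        have hPU := hP ((fun S => Prod.mk x ⁻¹' S) '' 𝒢) (hne.image _)
          (by
            rintro _ ⟨G, hG, rfl⟩
            exact hY.functionallyOpen ((hfo G hG).isOpen.preimage (Continuous.prodMk_right x)))
          (by
            rintro _ ⟨G, hG, rfl⟩ _ ⟨G', hG', rfl⟩
            obtain ⟨H, hH, h, h'⟩ := hdir G hG G' hG'
            exact ⟨_, ⟨H, hH, rfl⟩, preimage_mono h, preimage_mono h'⟩)
          (hY.functionallyOpen (isOpen_sUnion (by
            rintro _ ⟨G, hG, rfl⟩
            exact (hfo G hG).isOpen.preimage (Continuous.prodMk_right x))))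
        rw [sUnion_image, ← preimage_sUnion, iSup_image] at hPU
        rw [measureReal_def, ← ENNReal.ofReal_lt_iff_lt_toReal hc0 (measure_ne_top _ _), hPU] at hc
        simp only [lt_iSup_iff] at hc
        obtain ⟨G, hG, hc⟩ := hc
        exact ⟨⟨G, hG⟩, (ENNReal.ofReal_lt_iff_lt_toReal hc0 (measure_ne_top _ _)).1 hc⟩)
    exact hle.trans_eq (iSup_congr fun G => (hreal _ (hfo _ G.2)).symm)
  · have := Measure.measurable_coe hA |>.comp hQ
    refine this.aemeasurable.congr (.of_forall fun x => ?_)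
    simp [Q, Measure.map_apply (hmk x) hA]

/-- The continuous cutoff of the sublevel sets of a modulus: it vanishes where `τ ≤ ε / 2` and
equals one where `ε ≤ τ`. -/
def modulusCutoff {X : Type*} (τ : X → ℝ) (ε : ℝ) (x : X) : ℝ :=
  max 0 (min 1 (2 * τ x / ε - 1))

section Cutoff

variable {X : Type*} {τ : X → ℝ} {ε : ℝ}

lemma modulusCutoff_nonneg (x : X) : 0 ≤ modulusCutoff τ ε x := le_max_left _ _

lemma modulusCutoff_le_one (x : X) : modulusCutoff τ ε x ≤ 1 :=
  max_le zero_le_one (min_le_left _ _)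

lemma modulusCutoff_eq_one (hε : 0 < ε) {x : X} (hx : ε ≤ τ x) : modulusCutoff τ ε x = 1 := by
  have : 2 ≤ 2 * τ x / ε := by rw [le_div_iff₀ hε]; linarith
  rw [modulusCutoff, min_eq_left (by linarith), max_eq_right zero_le_one]

lemma support_modulusCutoff (hε : 0 < ε) :
    Function.support (modulusCutoff τ ε) ⊆ {x | ε / 2 < τ x} := by
  intro x hx
  by_contra h
  refine hx (max_eq_left ((min_le_right _ _).trans ?_))
  have : 2 * τ x / ε ≤ 1 := by
    rw [div_le_iff₀ hε]
    have : τ x ≤ ε / 2 := not_lt.1 h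
    linarith
  linarith

lemma testFun_mul_modulusCutoff [TopologicalSpace X] (hτ : Continuous τ) (hε : 0 < ε) {f : X → ℝ}
    (hf : Continuous f) (hf1 : ∀ x, |f x| ≤ 1) :
    TestFun (SIdeal τ) fun x => modulusCutoff τ ε x * f x := by
  have hcont : Continuous (modulusCutoff τ ε) := by unfold modulusCutoff; fun_prop
  refine ⟨hcont.mul hf, ⟨1, fun x => ?_⟩, ε / 2, half_pos hε, fun x hx => ?_⟩
  · rw [abs_mul, abs_of_nonneg (modulusCutoff_nonneg x)]
    exact mul_le_one₀ (modulusCutoff_le_one x) (abs_nonneg _) (hf1 x)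
  · exact (support_modulusCutoff hε (left_ne_zero_of_mul hx)).le

end Cutoff

lemma MemM.measure_modulus_lt_top {X : Type*} [TopologicalSpace X] [MeasurableSpace X]
    [OpensMeasurableSpace X] {τ : X → ℝ} (hτ : Continuous τ) {μ : Measure X}
    (hμ : MemM (SIdeal τ) μ) {ε : ℝ} (hε : 0 < ε) : μ {x | ε ≤ τ x} < ∞ :=
  hμ.1 _ ⟨ε, hε, fun _ hx => hx⟩ (measurableSet_le measurable_const hτ.measurable)

lemma TestFun.integrable {X : Type*} [TopologicalSpace X] [MeasurableSpace X]
    [OpensMeasurableSpace X] {τ : X → ℝ} (hτ : Continuous τ) {μ : Measure X}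
    (hμ : MemM (SIdeal τ) μ) {f : X → ℝ} (hf : TestFun (SIdeal τ) f) : Integrable f μ := by
  obtain ⟨hfc, ⟨C, hC⟩, ε, hε, hfε⟩ := hf
  exact integrable_of_bounded_of_support_subset hfc.measurable hC hfε
    (hμ.measure_modulus_lt_top hτ hε).ne

/-- The mixing laws `κ x` may be replaced by their weak limit inside `F`, uniformly up to a test
function with small `μ`-integral. -/
lemma TauAdditive.exists_testFun_error {X Y : Type*} [TopologicalSpace X] [TopologicalSpace Y]
    [MeasurableSpace X] [MeasurableSpace Y] [OpensMeasurableSpace X] [OpensMeasurableSpace Y]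
    (hX : PerfectlyNormal X) (hY : PerfectlyNormal Y) {μ : Measure X} (hμ : TauAdditive μ)
    {τ : X → ℝ} (hτ : Continuous τ) (hμM : MemM (SIdeal τ) μ)
    {P : Measure Y} [IsProbabilityMeasure P] (hP : TauAdditive P) {κ : X → Measure Y}
    [∀ x, IsProbabilityMeasure (κ x)]
    (hweak : ∀ h : Y → ℝ, Continuous h → (∃ C : ℝ, ∀ y, |h y| ≤ C) →
      Tendsto (fun x : X => ∫ y, h y ∂(κ x)) (Filter.comap τ atTop) (𝓝 (∫ y, h y ∂P)))
    {F : X × Y → ℝ} (hF : Continuous F) {C : ℝ} (hC : ∀ p, |F p| ≤ C) {ε : ℝ} (hε : 0 < ε)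
    (hFε : ∀ p, F p ≠ 0 → ε ≤ τ p.1) {η : ℝ} (hη : 0 < η) :
    ∃ D : X → ℝ, TestFun (SIdeal τ) D ∧ ∫ x, D x ∂μ < η ∧ ∃ R : ℝ, ∀ x' x,
      (ε ≤ τ x' → R ≤ τ x) → |∫ y, F (x', y) ∂κ x - ∫ y, F (x', y) ∂P| ≤ D x' := by
  obtain ⟨y₀⟩ := P.nonempty_of_neZero
  rcases isEmpty_or_nonempty X with hXe | ⟨⟨x₀⟩⟩
  · exact ⟨fun _ => 0, ⟨continuous_const, ⟨0, by simp⟩, ε, hε, by simp⟩, by simpa using hη, 0,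
      fun x => (IsEmpty.false x).elim⟩
  have hC0 : 0 ≤ C := (abs_nonneg _).trans (hC (x₀, y₀))
  set χ := modulusCutoff τ ε with hχdef
  have hχ : TestFun (SIdeal τ) χ := by
    simpa using testFun_mul_modulusCutoff hτ hε (continuous_const (y := (1 : ℝ))) (by simp)
  have hχi : Integrable χ μ := hχ.integrable hτ hμM
  set M := ∫ x, χ x ∂μ with hM
  have hM0 : 0 ≤ M := integral_nonneg fun x => modulusCutoff_nonneg x
  obtain ⟨δ, hδ, hδη⟩ : ∃ δ > 0, δ * (M + 2 * C) < η := by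
    refine ⟨η / (M + 2 * C + 1), by positivity, ?_⟩
    rw [div_mul_eq_mul_div, div_lt_iff₀ (by positivity)]
    nlinarith
  set W := {x | ε / 2 < τ x} with hWdef
  have hWo : IsOpen W := isOpen_lt continuous_const hτ
  have hWfin : μ W ≠ ∞ := measure_ne_top_of_subset (fun x (hx : ε / 2 < τ x) => hx.le)
    (hμM.measure_modulus_lt_top hτ (half_pos hε)).ne
  let 𝒢 : Set (Set X) := {G | IsOpen G ∧ G ⊆ W ∧ ∃ R : ℝ, ∀ x' ∈ G, ∀ x, R ≤ τ x →
    |∫ y, F (x', y) ∂κ x - ∫ y, F (x', y) ∂P| ≤ δ}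
  have hsU : ⋃₀ 𝒢 = W := by
    refine Subset.antisymm (sUnion_subset fun G hG => hG.2.1) fun x hx => ?_
    obtain ⟨U, hU, R, hR⟩ := hP.exists_uniform hY hweak hF hC x hδ
    exact ⟨interior U ∩ W, ⟨isOpen_interior.inter hWo, inter_subset_right, R,
      fun x' hx' => hR x' (interior_subset hx'.1)⟩, mem_interior_iff_mem_nhds.2 hU, hx⟩
  obtain ⟨G, ⟨hG, hGW, R, hR⟩, hlt⟩ := hμ.exists_measureReal_diff_lt hX (𝒢 := 𝒢)
    ⟨isOpen_empty, empty_subset _, 0, by simp⟩ (fun G hG => hG.1)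
    (by
      rintro G ⟨hG, hGW, R, hR⟩ G' ⟨hG', hGW', R', hR'⟩
      refine ⟨hG.union hG', union_subset hGW hGW', max R R', ?_⟩
      rintro x' (hx' | hx') x hx
      exacts [hR x' hx' x ((le_max_left _ _).trans hx),
        hR' x' hx' x ((le_max_right _ _).trans hx)]) hsU hWfin hδ
  obtain ⟨φ, hφ, hφ0, rfl⟩ := hX.functionallyOpen hG
  have hlim := tendsto_integral_mul_cutoff hφ.measurable hφ0 hχi
  have hmW : MeasurableSet (W \ {x | 0 < φ x}) := hWo.measurableSet.diff hG.measurableSet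
  have hle : ∫ x, {x | φ x = 0}.indicator χ x ∂μ ≤ μ.real (W \ {x | 0 < φ x}) := by
    have hfin : μ (W \ {x | 0 < φ x}) ≠ ∞ := measure_ne_top_of_subset sdiff_subset hWfin
    rw [← mul_one (μ.real _), ← smul_eq_mul, ← integral_indicator_const (1 : ℝ) hmW]
    refine integral_mono (hχi.indicator (hφ.measurable (measurableSet_singleton 0)))
      ((integrable_indicator_iff hmW).2 (integrableOn_const hfin)) fun x => ?_
    by_cases hx : φ x = 0
    · rw [indicator_of_mem (show x ∈ {x | φ x = 0} from hx)]
      by_cases hxW : x ∈ W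
      · rw [indicator_of_mem (show x ∈ W \ {x | 0 < φ x} from ⟨hxW, by simp [hx]⟩)]
        exact modulusCutoff_le_one x
      · rw [show χ x = 0 from Function.notMem_support.1 fun h => hxW (support_modulusCutoff hε h)]
        exact indicator_nonneg (fun _ _ => zero_le_one) x
    · rw [indicator_of_notMem (show x ∉ {x | φ x = 0} from hx)]
      exact indicator_nonneg (fun _ _ => zero_le_one) x
  obtain ⟨n, hn⟩ := (hlim.eventually_lt_const (hle.trans_lt hlt)).exists
  set ψ : X → ℝ := fun x => max 0 (1 - n * φ x)
  have hψ0 (x) : 0 ≤ ψ x := le_max_left _ _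
  have hψ1 (x) : ψ x ≤ 1 := max_le zero_le_one
    (by linarith [mul_nonneg (Nat.cast_nonneg (α := ℝ) n) (hφ0 x)])
  have hψ : Continuous ψ := by fun_prop
  have hχψ : Integrable (fun x => χ x * ψ x) μ :=
    (testFun_mul_modulusCutoff hτ hε hψ
      fun x => by rw [abs_of_nonneg (hψ0 x)]; exact hψ1 x).integrable hτ hμM
  refine ⟨fun x => δ * χ x + 2 * C * (χ x * ψ x), ⟨?_, ⟨δ + 2 * C, fun x => ?_⟩, ?_⟩, ?_, R,
    fun x' x hx => ?_⟩
  · exact (continuous_const.mul hχ.1).add (continuous_const.mul (hχ.1.mul hψ))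
  · have h0 : 0 ≤ χ x := modulusCutoff_nonneg x
    have h1 : χ x ≤ 1 := modulusCutoff_le_one x
    have hψx := hψ0 x
    rw [abs_of_nonneg (by positivity)]
    have : χ x * ψ x ≤ 1 := mul_le_one₀ h1 hψx (hψ1 x)
    nlinarith
  · refine ⟨ε / 2, half_pos hε, fun x hx => ?_⟩
    have : χ x ≠ 0 := fun h => hx (by simp [h])
    exact (support_modulusCutoff hε this).le
  · rw [integral_add (hχi.const_mul _) (hχψ.const_mul _), integral_const_mul,
      integral_const_mul, ← hM]
    have : 2 * C * ∫ x, χ x * ψ x ∂μ ≤ 2 * C * δ := by gcongr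
    linarith
  · rcases lt_or_ge (τ x') ε with h | h
    · have hz (y : Y) : F (x', y) = 0 := by
        by_contra h'
        exact h.not_ge (hFε _ h')
      have h0 : 0 ≤ χ x' := modulusCutoff_nonneg x'
      have hψx := hψ0 x'
      simp only [hz, integral_zero, sub_zero, abs_zero]
      positivity
    · have h1 : χ x' = 1 := modulusCutoff_eq_one hε h
      simp only [h1, mul_one, one_mul]
      by_cases hxG : 0 < φ x'
      · have := hR x' hxG x (hx h)
        have := hψ0 x'
        have : 0 ≤ 2 * C * ψ x' := by positivity
        linarith
      · have hz : φ x' = 0 := le_antisymm (not_lt.1 hxG) (hφ0 x')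
        have hψ1 : ψ x' = 1 := by simp [ψ, hz]
        have hb (Q : Measure Y) [IsProbabilityMeasure Q] : |∫ y, F (x', y) ∂Q| ≤ C :=
          abs_integral_le_of_forall_abs_le Q fun y => hC (x', y)
        rw [hψ1]
        linarith [abs_sub (∫ y, F (x', y) ∂κ x) (∫ y, F (x', y) ∂P), hb P, hb (κ x)]

lemma aemeasurable_section {X Z Y : Type*} [MeasurableSpace X] [MeasurableSpace Y]
    [MeasurableSpace Z] {m : Measure X} [IsProbabilityMeasure m] {κ : X → Measure Y}
    [∀ x, IsProbabilityMeasure (κ x)] {i : X → Y → Z} (hi : ∀ x, Measurable (i x)) {ν : Measure Z}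
    (hν : ∀ A, MeasurableSet A → ν A = ∫⁻ x, κ x (i x ⁻¹' A) ∂m) {A : Set Z}
    (hA : MeasurableSet A) : AEMeasurable (fun x => κ x (i x ⁻¹' A)) m := by
  have h1 : ν univ = 1 := by simp [hν univ .univ]
  refine aemeasurable_of_lintegral_add_compl_eq (v := fun x => κ x (i x ⁻¹' Aᶜ))
    (fun x => ?_) ?_
  · rw [preimage_compl, prob_add_prob_compl (hi x hA)]
  · rw [← hν A hA, ← hν _ hA.compl, measure_add_measure_compl hA, h1]

/-- regular variation of a pair with scaling acting on the first
component only. -/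
theorem statement7 {X Y : Type*} [TopologicalSpace X] [TopologicalSpace Y]
    [mX : MeasurableSpace X] [mY : MeasurableSpace Y] [mXY : MeasurableSpace (X × Y)]
    (hmX : mX = baire X) (hmY : mY = baire Y) (hmXY : mXY = baire (X × Y))
    (hPNX : PerfectlyNormal X) (hPNY : PerfectlyNormal Y)
    (T : ℝ → X → X) (hT : IsScaling T) (hTc : ContinuousScaling T)
    (τX : X → ℝ) (hτc : Continuous τX) (hτm : IsModulus T τX)
    (Pxi : Measure X) [IsProbabilityMeasure Pxi]
    (g : ℝ → ℝ) (μ : Measure X)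
    (hRV : MeasureRV T (SIdeal τX) g Pxi μ) (hμτ : TauAdditive μ)
    (κ : X → Measure Y)
    (hκmeas : ∀ B : Set Y, MeasurableSet B → Measurable fun x => κ x B)
    (hκprob : ∀ x : X, κ x Set.univ = 1)
    (PW : Measure Y) (hPWprob : PW Set.univ = 1) (hPWτ : TauAdditive PW)
    (hweak : ∀ h : Y → ℝ, Continuous h → (∃ C : ℝ, ∀ y, |h y| ≤ C) →
      Tendsto (fun x : X => ∫ y, h y ∂(κ x)) (Filter.comap τX atTop)
        (𝓝 (∫ y, h y ∂PW)))
    (ν : Measure (X × Y))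
    (hν : ∀ A : Set (X × Y), MeasurableSet A →
      ν A = ∫⁻ x, κ x {y | (x, y) ∈ A} ∂Pxi) :
    ∃ μ' : Measure (X × Y),
      TauAdditive μ' ∧
      (∀ (f : X → ℝ) (h : Y → ℝ), TestFun (SIdeal τX) f → Continuous h →
        (∃ C : ℝ, ∀ y, |h y| ≤ C) →
        ∫ p, f p.1 * h p.2 ∂μ' = (∫ x, f x ∂μ) * ∫ y, h y ∂PW) ∧
      MeasureRV (fun t (p : X × Y) => (T t p.1, p.2))
        {A : Set (X × Y) | ∃ B ∈ SIdeal τX, A ⊆ B ×ˢ (Set.univ : Set Y)} g ν μ' := by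
  have := hPNX.opensMeasurableSpace hmX
  have := hPNY.opensMeasurableSpace hmY
  have : IsProbabilityMeasure PW := ⟨hPWprob⟩
  have (x : X) : IsProbabilityMeasure (κ x) := ⟨hκprob x⟩
  have hmk (x : X) : Measurable (Prod.mk x : Y → X × Y) :=
    (Continuous.prodMk_right x).measurable_into_baire hmXY
  have hκae (A : Set (X × Y)) (hA : MeasurableSet A) :
      AEMeasurable (fun x => κ x (Prod.mk x ⁻¹' A)) Pxi := aemeasurable_section hmk hν hA
  have hνprob : IsProbabilityMeasure ν := ⟨by simp [hν univ .univ]⟩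
  obtain ⟨hg, hgpos, hgtop, hμM, ⟨B, ⟨ε₁, hε₁, hBε⟩, hμB⟩, hlim⟩ := hRV
  obtain ⟨μ', hμ'τ, hμ'⟩ := hμτ.exists_prod hmXY hPNX hPNY hPWτ
  have hcyl (s : Set X) (hs : MeasurableSet s) (hs' : MeasurableSet (s ×ˢ (univ : Set Y))) :
      μ' (s ×ˢ univ) = μ s := by
    rw [(hμ' _ hs').2, ← lintegral_indicator_one hs]
    refine lintegral_congr fun x => ?_
    by_cases hx : x ∈ s <;> simp [hx]
  have hτfst : Measurable fun p : X × Y => τX p.1 :=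
    (hτc.comp continuous_fst).measurable_of_eq_baire hmXY
  have hmε (ε : ℝ) : MeasurableSet ({x | ε ≤ τX x} ×ˢ (univ : Set Y)) := by
    rw [prod_univ]
    exact hτfst measurableSet_Ici
  have hμ'ε (ε : ℝ) : μ' ({x | ε ≤ τX x} ×ˢ univ) = μ {x | ε ≤ τX x} :=
    hcyl _ (hτc.measurable measurableSet_Ici) (hmε ε)
  set V : Set (Set (X × Y)) := {A | ∃ B ∈ SIdeal τX, A ⊆ B ×ˢ (univ : Set Y)} with hV
  have hVsub {A : Set (X × Y)} (hA : A ∈ V) : ∃ ε > 0, A ⊆ {x | ε ≤ τX x} ×ˢ univ := by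
    obtain ⟨B, ⟨ε, hε, hB⟩, hAB⟩ := hA
    exact ⟨ε, hε, hAB.trans (prod_mono hB subset_rfl)⟩
  have hμ'V {A : Set (X × Y)} (hA : A ∈ V) : μ' A < ∞ := by
    obtain ⟨ε, hε, hAε⟩ := hVsub hA
    refine (measure_mono hAε).trans_lt ?_
    rw [hμ'ε]
    exact hμM.measure_modulus_lt_top hτc hε
  have hint {F : X × Y → ℝ} (hF : TestFun V F) :
      ∫ p, F p ∂μ' = ∫ x, ∫ y, F (x, y) ∂PW ∂μ := by
    obtain ⟨hFc, ⟨C, hC⟩, hFV⟩ := hF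
    have hFm := hFc.measurable_of_eq_baire hmXY
    exact (integral_mixture hmk (fun A hA => (hμ' A hA).1) (fun A hA => (hμ' A hA).2) hFm hC
      (integrable_of_bounded_of_support_subset hFm hC subset_rfl (hμ'V hFV).ne)).2
  refine ⟨μ', hμ'τ, fun f h hf hh hhb => ?_, hg, hgpos, hgtop, ⟨fun A hA _ => hμ'V hA, ?_⟩,
    ?_, fun F hF => ?_⟩
  · have hfh : TestFun V fun p : X × Y => f p.1 * h p.2 := by
      obtain ⟨hfc, ⟨C, hC⟩, hfS⟩ := hf
      obtain ⟨D, hD⟩ := hhb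
      refine ⟨by fun_prop, ⟨C * D, fun p => ?_⟩, _, hfS, fun p hp =>
        ⟨left_ne_zero_of_mul hp, mem_univ _⟩⟩
      rw [abs_mul]
      exact mul_le_mul (hC _) (hD _) (abs_nonneg _) ((abs_nonneg _).trans (hC p.1))
    rw [hint hfh]
    simp_rw [integral_const_mul, integral_mul_const]
  · have hsub : (⋃₀ V)ᶜ ⊆ {x | τX x = 0} ×ˢ univ := by
      intro p hp
      refine ⟨?_, mem_univ _⟩
      by_contra h
      exact hp ⟨{x | τX p.1 ≤ τX x} ×ˢ univ, ⟨_, ⟨τX p.1, (hτm.1 _).lt_of_ne' h, fun x hx => hx⟩,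
        subset_rfl⟩, le_refl (τX p.1), mem_univ _⟩
    refine measure_mono_null hsub ?_
    rw [hcyl {x | τX x = 0} (hτc.measurable (measurableSet_singleton 0))
      (by rw [prod_univ]; exact hτfst (measurableSet_singleton 0))]
    refine measure_mono_null (fun x (hx : τX x = 0) => ?_) hμM.2
    rintro ⟨B, ⟨ε, hε, hB⟩, hxB⟩
    exact (hε.trans_le (hB x hxB)).ne' hx
  · refine ⟨{x | ε₁ ≤ τX x} ×ˢ univ, ⟨_, ⟨ε₁, hε₁, fun x hx => hx⟩, subset_rfl⟩, ?_⟩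
    rw [hμ'ε]
    exact hμB.trans_le (measure_mono hBε)
  rw [hint hF]
  obtain ⟨hFc, ⟨C, hC⟩, hFV⟩ := hF
  obtain ⟨ε, hε, hFε⟩ := hVsub hFV
  have hTt {t : ℝ} (ht : 0 < t) : Continuous (T t) :=
    hTc.comp_continuous (Continuous.prodMk_right t) fun x => ⟨ht, mem_univ _⟩
  have hΦ : TestFun (SIdeal τX) fun x => ∫ y, F (x, y) ∂PW := by
    refine ⟨hPWτ.continuous_integral hPNY hFc hC, ⟨C, fun x => ?_⟩, ε, hε, fun x hx => ?_⟩
    · exact abs_integral_le_of_forall_abs_le PW fun y => hC (x, y)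
    · by_contra hlt
      refine hx ?_
      have (y : Y) : F (x, y) = 0 := by
        by_contra h'
        exact hlt (hFε h').1
      simp [this]
  have hdiff : Tendsto (fun t : ℝ => g t * ∫ p, F (T t⁻¹ p.1, p.2) ∂ν -
      g t * ∫ x, ∫ y, F (T t⁻¹ x, y) ∂PW ∂Pxi) atTop (𝓝 0) := by
    rw [Metric.tendsto_nhds]
    intro η hη
    obtain ⟨D, hD, hDη, R, hR⟩ := hμτ.exists_testFun_error hPNX hPNY hτc hμM hPWτ hweak hFc hC hε
      (fun p hp => (hFε hp).1) hη
    filter_upwards [(hlim D hD).eventually_lt_const hDη, eventually_gt_atTop 0,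
      eventually_ge_atTop (R / ε)] with t htD ht htR
    have hTc' := hTt (inv_pos.2 ht)
    have hFt : Continuous fun p : X × Y => F (T t⁻¹ p.1, p.2) := by fun_prop
    have hFtm := hFt.measurable_of_eq_baire hmXY
    obtain ⟨hi, heq⟩ := integral_mixture hmk hκae hν hFtm (fun p => hC _)
      (.of_bound hFtm.aestronglyMeasurable C (.of_forall fun p => hC _))
    obtain ⟨hΦc, ⟨C₁, hC₁⟩, -⟩ := hΦ
    obtain ⟨hDc, ⟨C₂, hC₂⟩, -⟩ := hD
    have hΦi : Integrable (fun x => ∫ y, F (T t⁻¹ x, y) ∂PW) Pxi :=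
      .of_bound (hΦc.comp hTc').measurable.aestronglyMeasurable C₁ (.of_forall fun x => hC₁ _)
    have hDi : Integrable (fun x => D (T t⁻¹ x)) Pxi :=
      .of_bound (hDc.comp hTc').measurable.aestronglyMeasurable C₂ (.of_forall fun x => hC₂ _)
    rw [Real.dist_eq, sub_zero, heq, ← mul_sub, ← integral_sub hi hΦi, abs_mul,
      abs_of_pos (hgpos t ht)]
    refine lt_of_le_of_lt (mul_le_mul_of_nonneg_left ?_ (hgpos t ht).le) htD
    refine abs_integral_le_integral_abs.trans
      (integral_mono (hi.sub hΦi).abs hDi fun x => hR (T t⁻¹ x) x fun hx => ?_)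
    rw [hτm.2 _ (inv_pos.2 ht), le_inv_mul_iff₀ ht] at hx
    exact ((div_le_iff₀ hε).1 htR).trans hx
  simpa using hdiff.add (hlim _ hΦ)
end
end

section
/- Let (X, d) be a metric space with a scaling T, and let τ : X → [0, ∞] be a continuous modulus that is inf-compact, i.e. the set {x : τ(x) ≤ t} is compact for every t ∈ [0, ∞). Then the ideal S_τ generated by τ coincides with the metric exclusion ideal obtained by excluding the cone C = {x : τ(x) = 0}: for every subset A ⊆ X, inf_{x∈A} τ(x) > 0 if and only if inf{d(x, y) : x ∈ A, y ∈ C} > 0. -/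
open MeasureTheory Filter Topology Set
open scoped ENNReal NNReal

noncomputable section

/-- the ideal of an inf-compact continuous modulus is the metric
exclusion ideal of the cone `{τ = 0}`. -/
theorem statement18 {X : Type*} [MetricSpace X]
    (T : ℝ → X → X) (hT : IsScaling T)
    (τ : X → ℝ≥0∞) (hτc : Continuous τ) (hτm : IsModulusE T τ)
    (hic : ∀ r : ℝ≥0, IsCompact {x | τ x ≤ (r : ℝ≥0∞)}) :
    ∀ A : Set X,
      (∃ ε : ℝ≥0∞, 0 < ε ∧ ∀ x ∈ A, ε ≤ τ x) ↔
        ∃ δ : ℝ, 0 < δ ∧ ∀ x ∈ A, ∀ y ∈ {z : X | τ z = 0}, δ ≤ dist x y := by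
  intro A
  constructor
  · rintro ⟨ε, hε, hA⟩
    have hK : IsCompact {z : X | τ z = 0} := by simpa using hic 0
    have hU : IsOpen {z : X | τ z < ε} := isOpen_lt hτc continuous_const
    obtain ⟨δ, hδ, hsub⟩ := hK.exists_thickening_subset_open hU
      fun z (hz : τ z = 0) => show τ z < ε from hz ▸ hε
    refine ⟨δ, hδ, fun x hx y hy => ?_⟩
    by_contra! hlt
    have hxU : τ x < ε := hsub (Metric.mem_thickening_iff.2 ⟨y, hy, hlt⟩)
    exact absurd (hA x hx) hxU.not_ge
  · rintro ⟨δ, hδ, hA⟩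
    have hclosed : IsClosed {x : X | ∀ y ∈ {z : X | τ z = 0}, δ ≤ dist x y} := by
      simp only [ofPred_forall]
      exact isClosed_biInter fun y _ =>
        isClosed_le continuous_const (continuous_id.dist continuous_const)
    have hK := (hic 1).inter_right hclosed
    rcases eq_empty_or_nonempty
      ({x | τ x ≤ ((1 : ℝ≥0) : ℝ≥0∞)} ∩ {x : X | ∀ y ∈ {z : X | τ z = 0}, δ ≤ dist x y})
      with hempty | hne
    · refine ⟨1, one_pos, fun x hx => ?_⟩
      by_contra! hlt
      exact hempty.le ⟨by simpa using hlt.le, hA x hx⟩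
    · obtain ⟨m, hm, hmin⟩ := hK.exists_isMinOn hne hτc.continuousOn
      have hpos : 0 < τ m := by
        refine pos_iff_ne_zero.2 fun h0 => ?_
        have := hm.2 m h0
        rw [dist_self] at this
        exact this.not_gt hδ
      refine ⟨min 1 (τ m), lt_min one_pos hpos, fun x hx => ?_⟩
      rcases le_total (τ x) 1 with hle | hge
      · exact (min_le_right _ _).trans (hmin ⟨by simpa using hle, hA x hx⟩)
      · exact (min_le_left _ _).trans hge
end
end

section
/- Let X be a topological space with a scaling T and an ideal S, let μ ∈ M(S) be an α-homogeneous Baire measure for some α ∈ ℝ, and let τ be a continuous modulus on X. Then: (1) if B = {x : τ(x) > 1} belongs to S and μ(B) > 0, then α ≥ 0; (2) if B = {x : τ(x) ≤ 1} belongs to S and μ(B) > 0, then α ≤ 0; (3) if V is a semicone (T_t V ⊆ V for all t ≥ 1) with μ(V) < ∞, then μ({x ∈ V : τ(x) = t}) = 0 for every t > 0. -/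
open MeasureTheory Filter Topology Set
open scoped ENNReal NNReal

noncomputable section

theorem measurable_real_of_continuous_baire {X : Type*} [TopologicalSpace X]
    [mX : MeasurableSpace X] (hmX : mX = baire X) {f : X → ℝ} (hf : Continuous f) :
    Measurable f := by
  rw [measurable_iff_comap_le, hmX, BorelSpace.measurable_eq (α := ℝ)]
  exact le_iSup (fun g : { g : X → ℝ // Continuous g } =>
    MeasurableSpace.comap g.1 (borel ℝ)) ⟨f, hf⟩

theorem measurable_ennreal_of_continuous_baire {X : Type*} [TopologicalSpace X]
    [mX : MeasurableSpace X] (hmX : mX = baire X) {τ : X → ℝ≥0∞} (hτ : Continuous τ) :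
    Measurable τ := by
  let e := ENNReal.orderIsoUnitIntervalBirational.toHomeomorph
  have h : Measurable fun x => e (τ x) :=
    (measurable_real_of_continuous_baire hmX
      (continuous_subtype_val.comp (e.continuous.comp hτ))).subtype_mk
  simpa [Function.comp_def] using e.symm.continuous.measurable.comp h

theorem IsScaling.apply_inv_apply {X : Type*} {T : ℝ → X → X} (hT : IsScaling T) {t : ℝ}
    (ht : 0 < t) (x : X) : T t⁻¹ (T t x) = x := by
  rw [hT.2 _ _ (inv_pos.2 ht) ht, inv_mul_cancel₀ ht.ne', hT.1]

/-- One half of homogeneity holds for the outer measure of arbitrary sets. -/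
theorem HomogeneousMeasure.measure_le_image {X : Type*} [MeasurableSpace X] {T : ℝ → X → X}
    {α : ℝ} {μ : Measure X} (hhom : HomogeneousMeasure T α μ) (hT : IsScaling T) {t : ℝ}
    (ht : 0 < t) (A : Set X) :
    μ A ≤ ENNReal.ofReal (t⁻¹ ^ (-α)) * μ (T t '' A) := by
  rw [← measure_toMeasurable (T t '' A),
    ← hhom t⁻¹ (inv_pos.2 ht) _ (measurableSet_toMeasurable _ _)]
  refine measure_mono fun x hx => ⟨T t x, ?_, hT.apply_inv_apply ht x⟩
  exact subset_toMeasurable _ _ (mem_image_of_mem _ hx)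

/-- If some image `T t '' B` lies in `B`, where `0 < μ B < ∞`, then `t ^ (-α) ≤ 1`. -/
theorem HomogeneousMeasure.rpow_le_one {X : Type*} [MeasurableSpace X] {T : ℝ → X → X}
    {α : ℝ} {μ : Measure X} (hhom : HomogeneousMeasure T α μ) {t : ℝ} (ht : 0 < t) {B : Set X}
    (hB : MeasurableSet B) (hpos : 0 < μ B) (hfin : μ B < ⊤) (hsub : T t '' B ⊆ B) :
    t ^ (-α) ≤ 1 := by
  have h : ENNReal.ofReal (t ^ (-α)) * μ B ≤ 1 * μ B := by
    rw [← hhom t ht B hB, one_mul]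
    exact measure_mono hsub
  simpa using (ENNReal.mul_le_mul_iff_left hpos.ne' hfin.ne).1 h

/-- A semicone of finite measure meets each level set of a measurable modulus in a null set. -/
theorem HomogeneousMeasure.measure_semicone_level_eq_zero {X : Type*} [MeasurableSpace X]
    {T : ℝ → X → X} {α : ℝ} {μ : Measure X} (hhom : HomogeneousMeasure T α μ)
    (hT : IsScaling T) {τ : X → ℝ≥0∞} (hτ : Measurable τ) (hτm : IsModulusE T τ) {V : Set X}
    (hV : ∀ t : ℝ, 1 ≤ t → T t '' V ⊆ V) (hfin : μ V < ⊤) {t : ℝ} (ht : 0 < t) :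
    μ {x ∈ V | τ x = ENNReal.ofReal t} = 0 := by
  let s : ℕ → ℝ := fun n => 1 + 1 / ((n : ℝ) + 1)
  let L : ℕ → Set X := fun n => τ ⁻¹' {ENNReal.ofReal (s n * t)}
  have hs : ∀ n, 1 ≤ s n := fun n => le_add_of_nonneg_right (by positivity)
  have hs0 : ∀ n, 0 < s n := fun n => one_pos.trans_le (hs n)
  have hL : ∀ n, MeasurableSet (L n) := fun n => hτ (measurableSet_singleton _)
  have hdisj : Pairwise (Function.onFun Disjoint L) := by
    intro m n hmn
    refine Disjoint.preimage _ (disjoint_singleton.2 fun h => hmn ?_)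
    rw [ENNReal.ofReal_eq_ofReal_iff (by have := hs0 m; positivity)
      (by have := hs0 n; positivity)] at h
    have h' := mul_right_cancel₀ ht.ne' h
    simpa [s] using h'
  have hzero : Tendsto (fun n => μ.restrict V (L n)) atTop (𝓝 0) := by
    apply ENNReal.tendsto_atTop_zero_of_tsum_ne_top
    rw [← measure_iUnion hdisj hL]
    refine ((measure_mono (subset_univ _)).trans_lt ?_).ne
    rwa [Measure.restrict_apply_univ]
  have hs1 : Tendsto s atTop (𝓝 1) := by
    simpa [s] using (tendsto_one_div_add_atTop_nhds_zero_nat (𝕜 := ℝ)).const_add 1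
  have hc : Tendsto (fun n => ENNReal.ofReal ((s n)⁻¹ ^ (-α))) atTop (𝓝 1) := by
    have h := ENNReal.tendsto_ofReal
      ((hs1.inv₀ one_ne_zero).rpow_const (p := -α) (Or.inl (by norm_num)))
    simpa using h
  have hlim := ENNReal.Tendsto.mul hc (Or.inl one_ne_zero) hzero (Or.inr ENNReal.one_ne_top)
  rw [mul_zero] at hlim
  refine le_antisymm (ge_of_tendsto' hlim fun n => ?_) bot_le
  refine (hhom.measure_le_image hT (hs0 n) _).trans ?_
  rw [Measure.restrict_apply (hL n)]
  gcongr
  rintro _ ⟨x, ⟨hxV, hx⟩, rfl⟩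
  refine ⟨?_, hV _ (hs n) (mem_image_of_mem _ hxV)⟩
  simp only [L, mem_preimage, mem_singleton_iff]
  rw [hτm _ (hs0 n), hx, ENNReal.ofReal_mul (hs0 n).le]

/-- sign of the homogeneity index and null level sets of a modulus. -/
theorem statement19 {X : Type*} [TopologicalSpace X] [mX : MeasurableSpace X]
    (hmX : mX = baire X)
    (T : ℝ → X → X) (hT : IsScaling T)
    (S : Set (Set X)) (hS : IsSetIdeal S)
    (μ : Measure X) (hμ : MemM S μ)
    (α : ℝ) (hhom : HomogeneousMeasure T α μ)
    (τ : X → ℝ≥0∞) (hτc : Continuous τ) (hτm : IsModulusE T τ) :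
    (({x | 1 < τ x} ∈ S ∧ 0 < μ {x | 1 < τ x}) → 0 ≤ α) ∧
    (({x | τ x ≤ 1} ∈ S ∧ 0 < μ {x | τ x ≤ 1}) → α ≤ 0) ∧
    (∀ V : Set X, (∀ t : ℝ, 1 ≤ t → T t '' V ⊆ V) → μ V < ⊤ →
      ∀ t : ℝ, 0 < t → μ {x ∈ V | τ x = ENNReal.ofReal t} = 0) := by
  have hτ := measurable_ennreal_of_continuous_baire hmX hτc
  refine ⟨fun ⟨hB, hpos⟩ => ?_, fun ⟨hB, hpos⟩ => ?_, fun V hV hfin t ht =>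
    hhom.measure_semicone_level_eq_zero hT hτ hτm hV hfin ht⟩
  · have hm : MeasurableSet {x | 1 < τ x} := measurableSet_lt measurable_const hτ
    have h := hhom.rpow_le_one (t := 2) two_pos hm hpos (hμ.1 _ hB hm) (by
      rintro _ ⟨x, hx, rfl⟩
      rw [mem_ofPred_eq, hτm 2 two_pos]
      exact lt_of_lt_of_le hx (le_mul_of_one_le_left' (by simp)))
    by_contra! hα
    exact h.not_gt (Real.one_lt_rpow one_lt_two (neg_pos.2 hα))
  · have hm : MeasurableSet {x | τ x ≤ 1} := measurableSet_le hτ measurable_const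
    have h2 : (0 : ℝ) < 2⁻¹ := by norm_num
    have h := hhom.rpow_le_one (t := 2⁻¹) h2 hm hpos (hμ.1 _ hB hm) (by
      rintro _ ⟨x, hx, rfl⟩
      rw [mem_ofPred_eq, hτm _ h2]
      exact mul_le_one' (ENNReal.ofReal_le_one.2 (by norm_num)) hx)
    by_contra! hα
    exact h.not_gt (Real.one_lt_rpow_of_pos_of_lt_one_of_neg h2 (by norm_num) (neg_neg_of_pos hα))
end
end
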